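/- Let Σ₀ be a closed strictly convex smooth initial hypersurface enclosing a shrinking obstacle Φ. If u : 𝕊^n × [0,T) → ℝ is a smooth solution of the penalized problem (∗_δ), then −∂_t u ≤ C on 𝕊^n × [0,T), where C depends only on n, α, Σ₀, Φ and is independent of δ and T; explicitly one may take C = (max_{𝕊^n} u₀) · (1/ρ₀) · max{ max_{𝕊^n} K₀^α , ((nα+1)/(nαρ₀))^{nα} }, where ρ₀ = ½ min_{𝕊^n} φ_∞ and φ_∞ is the support function of the limit body ∩_{t≥0} Ω(t). -/

import Mathlib

/-!
STATEMENT 8: Let `Σ₀` be a closed strictly convex smooth initial hypersurface enclosing a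
shrinking obstacle `Φ`.  If `u : 𝕊ⁿ × [0,T) → ℝ` is a smooth solution of the penalized
problem `(∗_δ)`, then `−∂_t u ≤ C` on `𝕊ⁿ × [0,T)`, where `C` depends only on
`n, α, Σ₀, Φ` and is independent of `δ` and `T`; explicitly one may take
`C = (max_{𝕊ⁿ} u₀)·(1/ρ₀)·max{max_{𝕊ⁿ} K₀^α, ((nα+1)/(nαρ₀))^{nα}}`, where
`ρ₀ = ½ min_{𝕊ⁿ} φ_∞` and `φ_∞` is the support function of the limit body `∩_{t≥0} Ω(t)`.
-/

open scoped BigOperators RealInnerProductSpace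
noncomputable section

abbrev ES (n : ℕ) := EuclideanSpace ℝ (Fin (n + 1))

/-- The unit sphere `𝕊^n ⊂ ℝ^{n+1}`. -/
def Sph (n : ℕ) : Set (ES n) := Metric.sphere 0 1

/-- Second derivative of `f` at `z` in the directions `v, w`. -/
def hbil {F : Type*} [NormedAddCommGroup F] [NormedSpace ℝ F] (f : F → ℝ) (z v w : F) : ℝ :=
  fderiv ℝ (fun x => fderiv ℝ f x w) z v

/-- For the 1-homogeneous extension `U` of the support function of a convex body and a unit
vector `z`, `suppHessDet n U z = det(D²U(z) + z⊗z)` equals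
`det(∇̄_i∇̄_j u + u ḡ_{ij})/det(ḡ_{ij})`, the product of the principal radii of curvature;
the Gauss curvature at the point with outer normal `z` is its inverse,
`K = det ḡ/det(∇̄²u + uḡ) = (suppHessDet n U z)⁻¹`. -/
def suppHessDet (n : ℕ) (U : ES n → ℝ) (z : ES n) : ℝ :=
  (Matrix.of fun i j : Fin (n + 1) =>
      hbil U z (EuclideanSpace.single i 1) (EuclideanSpace.single j 1) +
        ⟪z, EuclideanSpace.single i 1⟫ * ⟪z, EuclideanSpace.single j 1⟫).det

/-- `u₀` is the (1-homogeneously extended) support function of a closed strictly convex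
smooth hypersurface. -/
def IsSupportOfSmoothBody (n : ℕ) (u₀ : ES n → ℝ) : Prop :=
  (∀ c : ℝ, 0 < c → ∀ x, u₀ (c • x) = c * u₀ x) ∧
    ContDiffOn ℝ (⊤ : ℕ∞) u₀ {(0 : ES n)}ᶜ ∧
    ∀ z ∈ Sph n, ∀ v : ES n, ⟪v, z⟫ = 0 → v ≠ 0 → 0 < hbil u₀ z v v

/-- A shrinking obstacle `Φ_t = ∂Ω(t)`: a decreasing family of strictly convex bodies
(whose limit contains the origin as interior point), with support functions
`φ ∈ C^{3,1}(𝕊ⁿ×[0,∞))` (extended 1-homogeneously), `∂_tφ < 0`, `−∂_tφ` non-increasing,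
and principal curvatures `μ_i` positive, non-decreasing in `t` and bounded. -/
structure ShrinkingObstacle (n : ℕ) : Type where
  φ : ES n → ℝ → ℝ
  homog : ∀ t : ℝ, 0 ≤ t → ∀ c : ℝ, 0 < c → ∀ x, φ (c • x) t = c * φ x t
  smooth : ContDiffOn ℝ 3 (fun p : ES n × ℝ => φ p.1 p.2) ({(0 : ES n)}ᶜ ×ˢ Set.Ici 0)
  φt : ES n → ℝ → ℝ
  hφt : ∀ z ∈ Sph n, ∀ t : ℝ, 0 ≤ t → HasDerivAt (φ z) (φt z t) t
  φt_neg : ∀ z ∈ Sph n, ∀ t : ℝ, 0 ≤ t → φt z t < 0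
  speed_nonincreasing : ∀ z ∈ Sph n, ∀ s t : ℝ, 0 ≤ s → s ≤ t → φt z s ≤ φt z t
  μ : Fin n → ES n → ℝ → ℝ
  μ_pos : ∀ i, ∀ z ∈ Sph n, ∀ t : ℝ, 0 ≤ t → 0 < μ i z t
  μ_eigen : ∀ z ∈ Sph n, ∀ t : ℝ, 0 ≤ t → ∃ e : Fin n → ES n, Orthonormal ℝ e ∧
    (∀ i, ⟪e i, z⟫ = 0) ∧
    ∀ i (v : ES n), hbil (fun x => φ x t) z (e i) v = (μ i z t)⁻¹ * ⟪e i, v⟫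
  μ_mono : ∀ i, ∀ z ∈ Sph n, ∀ s t : ℝ, 0 ≤ s → s ≤ t → μ i z s ≤ μ i z t
  μ_bdd : ∃ M : ℝ, ∀ i, ∀ z ∈ Sph n, ∀ t : ℝ, 0 ≤ t → μ i z t ≤ M
  interior_point : ∃ ρ : ℝ, 0 < ρ ∧ ∀ z ∈ Sph n, ∀ t : ℝ, 0 ≤ t → ρ ≤ φ z t

/-- The penalty function `β_δ(x) = C₀β(x/δ)`: smooth, non-decreasing, concave, vanishing on
`[δ,∞)`, affine on `(−∞,0)`, with `β_δ(0) = −C₀`. -/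
structure Penalty (δ C₀ : ℝ) : Type where
  β : ℝ → ℝ
  smooth : ContDiff ℝ (⊤ : ℕ∞) β
  mono : Monotone β
  concave : ConcaveOn ℝ Set.univ β
  zero_of_ge : ∀ x : ℝ, δ ≤ x → β x = 0
  affine_on_neg : ∀ x : ℝ, x < 0 → deriv (deriv β) x = 0
  at_zero : β 0 = -C₀

/-- `C₀ = ‖K_Φ‖_{L^∞(𝕊ⁿ×[0,∞))}^α`, where `K_Φ = μ₁⋯μ_n` is the Gauss curvature of the
obstacle. -/
def PenaltyConst (n : ℕ) (α : ℝ) (Φ : ShrinkingObstacle n) (C₀ : ℝ) : Prop :=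
  C₀ = sSup {y : ℝ | ∃ z ∈ Sph n, ∃ t : ℝ, 0 ≤ t ∧ y = (∏ i, Φ.μ i z t) ^ α}

/-- A smooth solution of the penalized problem `(∗_δ)` on `[0,T)`:
`−∂_t u = K^α + β_δ(u − φ)`, where `u(·,t)` is the (1-homogeneously extended) support
function of a closed strictly convex smooth hypersurface `Σ_t` and
`K = (suppHessDet)⁻¹` is its Gauss curvature. -/
structure IsPenalizedSol (n : ℕ) (α T δ C₀ : ℝ) (Φ : ShrinkingObstacle n)
    (P : Penalty δ C₀) (u : ES n → ℝ → ℝ) : Prop where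
  homog : ∀ t ∈ Set.Ico (0 : ℝ) T, ∀ c : ℝ, 0 < c → ∀ x, u (c • x) t = c * u x t
  smooth : ContDiffOn ℝ (⊤ : ℕ∞) (fun p : ES n × ℝ => u p.1 p.2) ({(0 : ES n)}ᶜ ×ˢ Set.Ico 0 T)
  strict_convex : ∀ t ∈ Set.Ico (0 : ℝ) T, ∀ z ∈ Sph n, ∀ v : ES n,
    ⟪v, z⟫ = 0 → v ≠ 0 → 0 < hbil (fun x => u x t) z v v
  eqn : ∀ z ∈ Sph n, ∀ t ∈ Set.Ioo (0 : ℝ) T,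
    HasDerivAt (u z)
      (-((suppHessDet n (fun x => u x t) z) ^ (-α)) - P.β (u z t - Φ.φ z t)) t

/-- The initial hypersurface (with support function `u₀`) strictly encloses the obstacle,
together with the standing normalization `−∂_tφ(·,0) < min_{𝕊ⁿ} K₀^α` and
`−∂_tφ(·,0) < min_{𝕊ⁿ} K_{Φ₀}^α`. -/
def Encloses (n : ℕ) (α : ℝ) (u₀ : ES n → ℝ) (Φ : ShrinkingObstacle n) : Prop :=
  (∀ z ∈ Sph n, Φ.φ z 0 < u₀ z) ∧
    (∀ z ∈ Sph n, ∀ z' ∈ Sph n, -Φ.φt z 0 < ((suppHessDet n u₀ z')⁻¹) ^ α) ∧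
    (∀ z ∈ Sph n, ∀ z' ∈ Sph n, -Φ.φt z 0 < (∏ i, Φ.μ i z' 0) ^ α)

section MatrixLemmas

open scoped Matrix

variable {ι : Type*} [Fintype ι] [DecidableEq ι]

lemma log_det_le_trace_sub_card {B : Matrix ι ι ℝ} (hB : B.PosDef) :
    Real.log B.det ≤ B.trace - Fintype.card ι := by
  have hpos := hB.eigenvalues_pos
  rw [hB.isHermitian.det_eq_prod_eigenvalues, hB.isHermitian.trace_eq_sum_eigenvalues]
  simp only [RCLike.ofReal_real_eq_id, id]
  rw [Real.log_prod fun i _ => (hpos i).ne']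
  calc ∑ i, Real.log (hB.isHermitian.eigenvalues i)
      ≤ ∑ i, (hB.isHermitian.eigenvalues i - 1) :=
        Finset.sum_le_sum fun i _ => Real.log_le_sub_one_of_pos (hpos i)
    _ = _ := by simp

lemma Matrix.PosDef.exists_inv_eq_conjTranspose_mul_self {A : Matrix ι ι ℝ} (hA : A.PosDef) :
    ∃ C : Matrix ι ι ℝ, A⁻¹ = Cᴴ * C := by
  open scoped MatrixOrder in
  obtain ⟨C, hC⟩ := CStarAlgebra.nonneg_iff_eq_star_mul_self.mp hA.inv.posSemidef.nonneg
  exact ⟨C, hC⟩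

lemma trace_inv_mul_nonneg {A H : Matrix ι ι ℝ} (hA : A.PosDef) (hH : H.PosSemidef) :
    0 ≤ (A⁻¹ * H).trace := by
  obtain ⟨C, hC⟩ := hA.exists_inv_eq_conjTranspose_mul_self
  rw [hC, Matrix.mul_assoc, Matrix.trace_mul_comm]
  exact (hH.mul_mul_conjTranspose_same C).trace_nonneg

lemma log_det_le_log_det_add_trace {A B : Matrix ι ι ℝ} (hA : A.PosDef) (hB : B.PosDef) :
    Real.log B.det ≤ Real.log A.det + (A⁻¹ * B).trace - Fintype.card ι := by
  obtain ⟨C, hC⟩ := hA.exists_inv_eq_conjTranspose_mul_self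
  have hdet : C.det * C.det = A.det⁻¹ := by
    have := congrArg Matrix.det hC
    rw [Matrix.det_mul, Matrix.det_conjTranspose, Matrix.det_nonsing_inv] at this
    simpa using this.symm
  have hBd : (C * B * Cᴴ).det = A.det⁻¹ * B.det := by
    rw [Matrix.det_mul, Matrix.det_mul, Matrix.det_conjTranspose, ← hdet]
    simp; ring
  have hP : (C * B * Cᴴ).PosDef := by
    rw [(hB.posSemidef.mul_mul_conjTranspose_same C).posDef_iff_det_ne_zero, hBd]
    exact mul_ne_zero (inv_ne_zero hA.det_pos.ne') hB.det_pos.ne'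
  have h := log_det_le_trace_sub_card hP
  rw [hBd, Real.log_mul (inv_ne_zero hA.det_pos.ne') hB.det_pos.ne', Real.log_inv,
    Matrix.mul_assoc, Matrix.trace_mul_comm C, Matrix.mul_assoc, Matrix.trace_mul_comm B,
    ← hC] at h
  linarith

lemma det_le_det_of_sub_posSemidef {A B : Matrix ι ι ℝ} (hA : A.PosDef) (hB : B.PosDef)
    (h : (A - B).PosSemidef) : B.det ≤ A.det := by
  have h1 := log_det_le_log_det_add_trace hA hB
  have h2 := trace_inv_mul_nonneg hA h
  rw [Matrix.mul_sub, Matrix.nonsing_inv_mul _ hA.det_pos.ne'.isUnit, Matrix.trace_sub,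
    Matrix.trace_one] at h2
  exact (Real.log_le_log_iff hB.det_pos hA.det_pos).1 (by linarith)

lemma hasDerivAt_det {A : ℝ → Matrix ι ι ℝ} {A' : Matrix ι ι ℝ} {t : ℝ}
    (hA : ∀ᶠ s in nhds t, (A s).PosDef) (hd : ∀ i j, HasDerivAt (fun s => A s i j) (A' i j) t) :
    HasDerivAt (fun s => (A s).det) ((A t).det * ((A t)⁻¹ * A').trace) t := by
  have hAt : (A t).PosDef := hA.self_of_nhds
  have hdiff : DifferentiableAt ℝ (fun s => (A s).det) t := by
    simp only [Matrix.det_apply]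
    refine DifferentiableAt.fun_sum fun σ _ => DifferentiableAt.const_smul ?_ _
    exact DifferentiableAt.fun_finsetProd fun i _ => (hd _ _).differentiableAt
  have htr : HasDerivAt (fun s => ((A t)⁻¹ * A s).trace) (((A t)⁻¹ * A').trace) t := by
    simp only [Matrix.trace, Matrix.diag, Matrix.mul_apply]
    exact HasDerivAt.fun_sum fun i _ => HasDerivAt.fun_sum fun j _ => (hd j i).const_mul _
  have hlog := (hdiff.hasDerivAt.log hAt.det_pos.ne').sub htr
  have hmax : IsLocalMax (fun s => Real.log (A s).det - ((A t)⁻¹ * A s).trace) t := by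
    filter_upwards [hA] with s hs
    have h := log_det_le_log_det_add_trace hAt hs
    rw [Matrix.nonsing_inv_mul _ hAt.det_pos.ne'.isUnit, Matrix.trace_one]
    linarith
  have h0 := hmax.hasDerivAt_eq_zero hlog
  have : deriv (fun s => (A s).det) t = (A t).det * ((A t)⁻¹ * A').trace := by
    have hp := hAt.det_pos.ne'
    field_simp at h0
    linarith
  exact this ▸ hdiff.hasDerivAt

lemma inv_mulVec_of_mulVec_eq {A : Matrix ι ι ℝ} (hA : A.PosDef) {z : ι → ℝ}
    (h : A.mulVec z = z) : A⁻¹.mulVec z = z := by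
  conv_lhs => rw [← h]
  rw [Matrix.mulVec_mulVec, Matrix.nonsing_inv_mul _ hA.det_pos.ne'.isUnit, Matrix.one_mulVec]

lemma trace_inv_mul_vecMulVec {A : Matrix ι ι ℝ} (hA : A.PosDef) {z : ι → ℝ}
    (h : A.mulVec z = z) (hz : z ⬝ᵥ z = 1) : (A⁻¹ * Matrix.vecMulVec z z).trace = 1 := by
  rw [Matrix.mul_vecMulVec, inv_mulVec_of_mulVec_eq hA h, Matrix.trace_vecMulVec, hz]

lemma posSemidef_one_sub_vecMulVec {z : ι → ℝ} (hz : z ⬝ᵥ z = 1) :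
    (1 - Matrix.vecMulVec z z).PosSemidef := by
  have h : (1 - Matrix.vecMulVec z z) =
      (1 - Matrix.vecMulVec z z).conjTranspose * (1 - Matrix.vecMulVec z z) := by
    have h1 : (1 - Matrix.vecMulVec z z).conjTranspose = 1 - Matrix.vecMulVec z z := by
      ext i j
      simp [Matrix.vecMulVec_apply, Matrix.one_apply, eq_comm, mul_comm]
    rw [h1, Matrix.sub_mul, Matrix.mul_sub, Matrix.mul_sub, Matrix.vecMulVec_mul_vecMulVec, hz]
    simp
  rw [h]
  exact Matrix.posSemidef_conjTranspose_mul_self _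

lemma card_sub_one_mul_rpow_le_trace_inv {n : ℕ} (hn : 0 < n)
    {A : Matrix (Fin (n + 1)) (Fin (n + 1)) ℝ} (hA : A.PosDef) {z : Fin (n + 1) → ℝ}
    (h : A.mulVec z = z) (hz : z ⬝ᵥ z = 1) :
    (n : ℝ) * A.det ^ (-(1 / (n : ℝ))) ≤ A⁻¹.trace - 1 := by
  have hd := hA.det_pos
  have hn' : (n : ℝ) ≠ 0 := by positivity
  set b : ℝ := A.det ^ (1 / (n : ℝ)) with hb
  have hbpos : 0 < b := Real.rpow_pos_of_pos hd _
  set B : Matrix (Fin (n + 1)) (Fin (n + 1)) ℝ :=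
    b • (1 - Matrix.vecMulVec z z) + Matrix.vecMulVec z z with hBdef
  have hBdet : B.det = b ^ n := by
    have : B = b • (1 + Matrix.replicateCol Unit ((1 / b - 1) • z) * Matrix.replicateRow Unit z) := by
      ext i j
      simp only [hBdef, Matrix.add_apply, Matrix.smul_apply, Matrix.sub_apply,
        Matrix.vecMulVec_apply, Matrix.mul_apply, Matrix.replicateCol_apply,
        Matrix.replicateRow_apply, Pi.smul_apply, smul_eq_mul, Finset.univ_unique,
        Finset.sum_singleton]
      field_simp
      ring
    rw [this, Matrix.det_smul, Matrix.det_one_add_replicateCol_mul_replicateRow, dotProduct_smul, hz,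
      Fintype.card_fin, smul_eq_mul, pow_succ]
    field_simp
    ring
  have hB : B.PosDef := by
    have h1 : B.PosSemidef := by
      refine ((posSemidef_one_sub_vecMulVec hz).smul hbpos.le).add ?_
      simpa using Matrix.posSemidef_vecMulVec_self_star z
    rw [h1.posDef_iff_det_ne_zero, hBdet]
    positivity
  have key := log_det_le_log_det_add_trace hA hB
  have htr : (A⁻¹ * B).trace = b * (A⁻¹.trace - 1) + 1 := by
    rw [hBdef, Matrix.mul_add, Matrix.mul_smul, Matrix.mul_sub, Matrix.mul_one, Matrix.trace_add,
      Matrix.trace_smul, Matrix.trace_sub, trace_inv_mul_vecMulVec hA h hz, smul_eq_mul]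
  rw [htr, hBdet, Real.log_pow, hb, Real.log_rpow hd, Fintype.card_fin] at key
  push_cast at key
  rw [← hb, ← mul_assoc, mul_one_div_cancel hn', one_mul] at key
  rw [Real.rpow_neg hd.le, ← hb, ← div_eq_mul_inv, div_le_iff₀ hbpos]
  linarith

end MatrixLemmas

section SliceLemmas

variable {E : Type*} [NormedAddCommGroup E] [NormedSpace ℝ E]

open Set Filter Topology

lemma hasFDerivAt_slice {f : E → ℝ → ℝ} {U : Set E} {I : Set ℝ} {x : E} {t : ℝ}
    (hU : IsOpen U) (hx : x ∈ U) (ht : t ∈ I)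
    (hf : DifferentiableWithinAt ℝ (fun p : E × ℝ => f p.1 p.2) (U ×ˢ I) (x, t)) :
    HasFDerivAt (fun y => f y t)
      ((fderivWithin ℝ (fun p : E × ℝ => f p.1 p.2) (U ×ˢ I) (x, t)).comp
        (ContinuousLinearMap.inl ℝ E ℝ)) x := by
  have h1 : HasFDerivWithinAt (fun y : E => (y, t)) (ContinuousLinearMap.inl ℝ E ℝ) U x :=
    (hasFDerivAt_prodMk_left x t).hasFDerivWithinAt
  have h2 := HasFDerivWithinAt.comp x hf.hasFDerivWithinAt h1
    (show MapsTo (fun y : E => (y, t)) U (U ×ˢ I) from fun y hy => ⟨hy, ht⟩)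
  exact h2.hasFDerivAt (hU.mem_nhds hx)

lemma hasDerivWithinAt_slice {f : E → ℝ → ℝ} {U : Set E} {I : Set ℝ} {x : E} {t : ℝ}
    (hx : x ∈ U)
    (hf : DifferentiableWithinAt ℝ (fun p : E × ℝ => f p.1 p.2) (U ×ˢ I) (x, t)) :
    HasDerivWithinAt (f x)
      (fderivWithin ℝ (fun p : E × ℝ => f p.1 p.2) (U ×ˢ I) (x, t) (0, 1)) I t := by
  have h1 : HasDerivWithinAt (fun s : ℝ => (x, s)) ((0 : E), (1 : ℝ)) I t :=
    (hasDerivWithinAt_const _ _ _).prodMk (hasDerivWithinAt_id _ _)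
  exact HasFDerivWithinAt.comp_hasDerivWithinAt t hf.hasFDerivWithinAt h1
    (show MapsTo (fun s : ℝ => (x, s)) I (U ×ˢ I) from fun s hs => ⟨hx, hs⟩)

lemma contDiffOn_fderiv_slice {f : E → ℝ → ℝ} {U : Set E} {I : Set ℝ}
    (hU : IsOpen U) (hI : UniqueDiffOn ℝ I)
    (hf : ContDiffOn ℝ (⊤ : ℕ∞) (fun p : E × ℝ => f p.1 p.2) (U ×ˢ I)) (w : E) :
    ContDiffOn ℝ (⊤ : ℕ∞) (fun p : E × ℝ => fderiv ℝ (fun y => f y p.2) p.1 w) (U ×ˢ I) := by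
  have h1 : ContDiffOn ℝ (⊤ : ℕ∞) (fderivWithin ℝ (fun p : E × ℝ => f p.1 p.2) (U ×ˢ I))
      (U ×ˢ I) := hf.fderivWithin (hU.uniqueDiffOn.prod hI) (by simp)
  have h2 := h1.clm_apply (contDiffOn_const (c := ((w, 0) : E × ℝ)))
  refine h2.congr fun p hp => ?_
  rw [(hasFDerivAt_slice hU hp.1 hp.2 (hf.differentiableOn (by simp) p hp)).fderiv]
  simp

lemma contDiffOn_hbil_slice {f : E → ℝ → ℝ} {U : Set E} {I : Set ℝ}
    (hU : IsOpen U) (hI : UniqueDiffOn ℝ I)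
    (hf : ContDiffOn ℝ (⊤ : ℕ∞) (fun p : E × ℝ => f p.1 p.2) (U ×ˢ I)) (v w : E) :
    ContDiffOn ℝ (⊤ : ℕ∞) (fun p : E × ℝ => hbil (fun y => f y p.2) p.1 v w) (U ×ˢ I) :=
  contDiffOn_fderiv_slice (f := fun y t => fderiv ℝ (fun x => f x t) y w) hU hI
    (contDiffOn_fderiv_slice hU hI hf w) v

lemma contDiffOn_derivWithin_slice {f : E → ℝ → ℝ} {U : Set E} {I : Set ℝ}
    (hU : IsOpen U) (hI : UniqueDiffOn ℝ I)
    (hf : ContDiffOn ℝ (⊤ : ℕ∞) (fun p : E × ℝ => f p.1 p.2) (U ×ˢ I)) :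
    ContDiffOn ℝ (⊤ : ℕ∞) (fun p : E × ℝ => derivWithin (f p.1) I p.2) (U ×ˢ I) := by
  have h1 : ContDiffOn ℝ (⊤ : ℕ∞) (fderivWithin ℝ (fun p : E × ℝ => f p.1 p.2) (U ×ˢ I))
      (U ×ˢ I) := hf.fderivWithin (hU.uniqueDiffOn.prod hI) (by simp)
  have h2 := h1.clm_apply (contDiffOn_const (c := (((0 : E), (1 : ℝ)))))
  refine h2.congr fun p hp => ?_
  exact (hasDerivWithinAt_slice hp.1 (hf.differentiableOn (by simp) p hp)).derivWithin
    (hI p.2 hp.2)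

lemma contDiffOn_slice {f : E → ℝ → ℝ} {U : Set E} {I : Set ℝ} {m : WithTop ℕ∞}
    (hf : ContDiffOn ℝ m (fun p : E × ℝ => f p.1 p.2) (U ×ˢ I)) {t : ℝ} (ht : t ∈ I) :
    ContDiffOn ℝ m (fun y => f y t) U :=
  hf.comp (f := fun y : E => (y, t)) (contDiff_id.prodMk contDiff_const).contDiffOn
    fun _ hy => ⟨hy, ht⟩

lemma hasDerivAt_fderiv_slice {f : E → ℝ → ℝ} {U : Set E} {I : Set ℝ}
    (hU : IsOpen U) {x : E} {t : ℝ} (hx : x ∈ U) (ht : t ∈ interior I)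
    (hf : ContDiffOn ℝ (⊤ : ℕ∞) (fun p : E × ℝ => f p.1 p.2) (U ×ˢ I)) (w : E) :
    HasDerivAt (fun s => fderiv ℝ (fun y => f y s) x w)
      (fderiv ℝ (fun y => derivWithin (f y) I t) x w) t := by
  set F : E × ℝ → ℝ := fun p => f p.1 p.2 with hF
  have hnhds : ∀ y ∈ U, ∀ s ∈ interior I, U ×ˢ I ∈ 𝓝 (y, s) := fun _ hy _ hs =>
    prod_mem_nhds (hU.mem_nhds hy) (mem_interior_iff_mem_nhds.1 hs)
  have hdiff : ∀ y ∈ U, ∀ s ∈ interior I, HasFDerivAt F (fderiv ℝ F (y, s)) (y, s) :=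
    fun _ hy _ hs => ((hf.contDiffAt (hnhds _ hy _ hs)).differentiableAt (by simp)).hasFDerivAt
  have h2 : ContDiffAt ℝ (⊤ : ℕ∞) F (x, t) := hf.contDiffAt (hnhds x hx t ht)
  have hD : HasFDerivAt (fderiv ℝ F) (fderiv ℝ (fderiv ℝ F) (x, t)) (x, t) :=
    ((h2.fderiv_right (m := (⊤ : ℕ∞)) (by simp)).differentiableAt (by simp)).hasFDerivAt
  have hsymm : IsSymmSndFDerivAt ℝ F (x, t) :=
    h2.isSymmSndFDerivAt (by simpa using WithTop.coe_le_coe.2 (le_top : (2 : ℕ∞) ≤ ⊤))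
  have hA : HasDerivAt (fun s => fderiv ℝ F (x, s) (w, 0))
      (fderiv ℝ (fderiv ℝ F) (x, t) (0, 1) (w, 0)) t := by
    have h1 : HasDerivAt (fun s : ℝ => (x, s)) ((0 : E), (1 : ℝ)) t :=
      (hasDerivAt_const _ _).prodMk (hasDerivAt_id _)
    have h3 := (HasFDerivAt.comp_hasDerivAt t hD h1).clm_apply (hasDerivAt_const t ((w, 0) : E × ℝ))
    simpa using h3
  have hB : HasFDerivAt (fun y => fderiv ℝ F (y, t) (0, 1))
      (((fderiv ℝ (fderiv ℝ F) (x, t)).comp (ContinuousLinearMap.inl ℝ E ℝ)).flip (0, 1)) x := by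
    have h3 := (HasFDerivAt.comp (f := fun y : E => (y, t)) x hD (hasFDerivAt_prodMk_left x t)).clm_apply
      (hasFDerivAt_const ((0 : E), (1 : ℝ)) x)
    simpa using h3
  have hB' : fderiv ℝ (fun y => derivWithin (f y) I t) x w =
      fderiv ℝ (fderiv ℝ F) (x, t) (0, 1) (w, 0) := by
    have heq : (fun y => derivWithin (f y) I t) =ᶠ[𝓝 x] fun y => fderiv ℝ F (y, t) (0, 1) := by
      filter_upwards [hU.mem_nhds hx] with y hy
      have h1 : HasDerivAt (fun s : ℝ => (y, s)) ((0 : E), (1 : ℝ)) t :=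
        (hasDerivAt_const _ _).prodMk (hasDerivAt_id _)
      have h3 := HasFDerivAt.comp_hasDerivAt t (hdiff y hy t ht) h1
      rw [derivWithin_of_mem_nhds (mem_interior_iff_mem_nhds.1 ht)]
      exact h3.deriv
    rw [heq.fderiv_eq, hB.fderiv, hsymm.eq]
    simp
  rw [hB']
  refine hA.congr_of_eventuallyEq ?_
  filter_upwards [isOpen_interior.mem_nhds ht] with s hs
  have h3 := HasFDerivAt.comp (f := fun y : E => (y, s)) x (hdiff x hx s hs) (hasFDerivAt_prodMk_left x s)
  have h4 : fderiv ℝ (fun y => f y s) x = _ := h3.fderiv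
  rw [h4]
  simp

lemma hasDerivAt_hbil_slice {f : E → ℝ → ℝ} {U : Set E} {I : Set ℝ}
    (hU : IsOpen U) (hI : UniqueDiffOn ℝ I) {x : E} {t : ℝ} (hx : x ∈ U) (ht : t ∈ interior I)
    (hf : ContDiffOn ℝ (⊤ : ℕ∞) (fun p : E × ℝ => f p.1 p.2) (U ×ˢ I)) (v w : E) :
    HasDerivAt (fun s => hbil (fun y => f y s) x v w)
      (hbil (fun y => derivWithin (f y) I t) x v w) t := by
  have h := hasDerivAt_fderiv_slice (f := fun y s => fderiv ℝ (fun x => f x s) y w) hU hx ht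
    (contDiffOn_fderiv_slice hU hI hf w) v
  have heq : (fun y => derivWithin (fun s => fderiv ℝ (fun x => f x s) y w) I t) =ᶠ[𝓝 x]
      fun y => fderiv ℝ (fun x => derivWithin (f x) I t) y w := by
    filter_upwards [hU.mem_nhds hx] with y hy
    rw [derivWithin_of_mem_nhds (mem_interior_iff_mem_nhds.1 ht)]
    exact (hasDerivAt_fderiv_slice hU hy ht hf w).deriv
  rw [heq.fderiv_eq] at h
  exact h

lemma hasFDerivAt_fderiv {f : E → ℝ} {z : E} (hf : ContDiffAt ℝ 2 f z) :
    HasFDerivAt (fderiv ℝ f) (fderiv ℝ (fderiv ℝ f) z) z :=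
  ((hf.fderiv_right (m := 1) (by norm_num)).differentiableAt (by simp)).hasFDerivAt

lemma hbil_eq {f : E → ℝ} {z : E} (hf : ContDiffAt ℝ 2 f z) (v w : E) :
    hbil f z v w = fderiv ℝ (fderiv ℝ f) z v w := by
  have h := (hasFDerivAt_fderiv hf).clm_apply (hasFDerivAt_const w z)
  rw [hbil, h.fderiv]
  simp

lemma hbil_comm {f : E → ℝ} {z : E} (hf : ContDiffAt ℝ 2 f z) (v w : E) :
    hbil f z v w = hbil f z w v := by
  rw [hbil_eq hf, hbil_eq hf]
  exact (hf.isSymmSndFDerivAt (by simp)).eq v w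

lemma hbil_congr {f g : E → ℝ} {z : E} (h : f =ᶠ[𝓝 z] g) (v w : E) :
    hbil f z v w = hbil g z v w := by
  have : (fun x => fderiv ℝ f x w) =ᶠ[𝓝 z] fun x => fderiv ℝ g x w := by
    filter_upwards [h.eventuallyEq_nhds] with x hx
    rw [hx.fderiv_eq]
  rw [hbil, hbil, this.fderiv_eq]

lemma hbil_sub {f g : E → ℝ} {z : E} (hf : ContDiffAt ℝ 2 f z) (hg : ContDiffAt ℝ 2 g z)
    (v w : E) : hbil (fun x => f x - g x) z v w = hbil f z v w - hbil g z v w := by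
  have heq : fderiv ℝ (fun x => f x - g x) =ᶠ[𝓝 z] fun x => fderiv ℝ f x - fderiv ℝ g x := by
    filter_upwards [hf.eventually (by simp), hg.eventually (by simp)] with x h1 h2
    exact fderiv_fun_sub (h1.differentiableAt (by simp)) (h2.differentiableAt (by simp))
  rw [hbil_eq hf, hbil_eq hg, hbil_eq (hf.sub hg), heq.fderiv_eq,
    ((hasFDerivAt_fderiv hf).fun_sub (hasFDerivAt_fderiv hg)).fderiv]
  simp

lemma hbil_const_mul {f : E → ℝ} {z : E} (hf : ContDiffAt ℝ 2 f z) (c : ℝ)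
    (v w : E) : hbil (fun x => c * f x) z v w = c * hbil f z v w := by
  have heq : fderiv ℝ (fun x => c * f x) =ᶠ[𝓝 z] fun x => c • fderiv ℝ f x := by
    filter_upwards [hf.eventually (by simp)] with x h1
    exact fderiv_const_mul (h1.differentiableAt (by simp)) c
  rw [hbil_eq hf, hbil_eq (contDiffAt_const.mul hf), heq.fderiv_eq,
    ((hasFDerivAt_fderiv hf).fun_const_smul c).fderiv]
  simp

lemma hbil_self_nonneg_of_isLocalMin {f : E → ℝ} {z : E} (hf : ContDiffAt ℝ 2 f z)
    (hmin : IsLocalMin f z) (v : E) : 0 ≤ hbil f z v v := by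
  by_contra! hneg
  set γ : ℝ → E := fun s => z + s • v with hγ
  have hγ0 : γ 0 = z := by simp [hγ]
  have hγd : ∀ s, HasDerivAt γ v s := fun s => by
    simpa [hγ] using ((hasDerivAt_id s).smul_const v).const_add z
  have hγc : Tendsto γ (𝓝 0) (𝓝 z) := by
    have := (hγd 0).continuousAt.tendsto
    rwa [hγ0] at this
  set g : ℝ → ℝ := fun s => f (γ s) with hg
  have hg1 : ∀ᶠ s in 𝓝 (0 : ℝ), HasDerivAt g (fderiv ℝ f (γ s) v) s := by
    filter_upwards [hγc.eventually (hf.eventually (by simp))] with s hs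
    exact (hs.differentiableAt (by simp)).hasFDerivAt.comp_hasDerivAt s (hγd s)
  have hg1' : deriv g =ᶠ[𝓝 0] fun s => fderiv ℝ f (γ s) v := hg1.mono fun s hs => hs.deriv
  have hg2 : HasDerivAt (deriv g) (hbil f z v v) 0 := by
    refine HasDerivAt.congr_of_eventuallyEq ?_ hg1'
    have h1 : HasFDerivAt (fderiv ℝ f) (fderiv ℝ (fderiv ℝ f) z) (γ 0) := by
      rw [hγ0]; exact hasFDerivAt_fderiv hf
    have h2 := (h1.comp_hasDerivAt 0 (hγd 0)).clm_apply (hasDerivAt_const 0 v)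
    rw [hbil_eq hf]
    simpa using h2
  have hgmin : IsLocalMin g 0 := by
    have : ∀ᶠ s in 𝓝 (0 : ℝ), f z ≤ f (γ s) := hγc.eventually hmin
    filter_upwards [this] with s hs
    simpa [hg, hγ0] using hs
  have hgmax : IsLocalMax g 0 :=
    isLocalMax_of_deriv_deriv_neg (by rw [hg2.deriv]; exact hneg) hgmin.deriv_eq_zero
      hg1.self_of_nhds.continuousAt
  have hconst : g =ᶠ[𝓝 0] fun _ => g 0 := by
    filter_upwards [hgmin, hgmax] with s h1 h2 using le_antisymm h2 h1
  have h3 : deriv g =ᶠ[𝓝 0] fun _ => (0 : ℝ) := by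
    filter_upwards [hconst.eventuallyEq_nhds] with s hs
    rw [hs.deriv_eq]; simp
  have h4 : deriv (deriv g) 0 = 0 := by rw [h3.deriv_eq]; simp
  rw [hg2.deriv] at h4
  linarith

lemma hbil_self_right_of_homogeneous {f : E → ℝ} {z : E} (hz : z ≠ 0)
    (hf : ContDiffOn ℝ 2 f {(0 : E)}ᶜ) (hom : ∀ c : ℝ, 0 < c → ∀ x, x ≠ 0 → f (c • x) = c * f x)
    (v : E) : hbil f z v z = 0 := by
  have hat : ∀ x : E, x ≠ 0 → ContDiffAt ℝ 2 f x := fun x hx =>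
    hf.contDiffAt (isOpen_compl_singleton.mem_nhds hx)
  have euler : ∀ x : E, x ≠ 0 → fderiv ℝ f x x = f x := by
    intro x hx
    have h1 : HasDerivAt (fun s : ℝ => s • x) x 1 := by
      simpa using (hasDerivAt_id (1 : ℝ)).smul_const x
    have h2 : HasFDerivAt f (fderiv ℝ f x) ((1 : ℝ) • x) := by
      rw [one_smul]; exact ((hat x hx).differentiableAt (by simp)).hasFDerivAt
    have h3 := h2.comp_hasDerivAt (1 : ℝ) h1
    have h4 : HasDerivAt (fun s : ℝ => s * f x) (f x) 1 := by
      simpa using (hasDerivAt_id (1 : ℝ)).mul_const (f x)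
    refine h3.unique (h4.congr_of_eventuallyEq ?_)
    filter_upwards [lt_mem_nhds (zero_lt_one (α := ℝ))] with s hs
    exact hom s hs x hx
  have h1 := (hasFDerivAt_fderiv (hat z hz)).clm_apply (hasFDerivAt_id z)
  have h2 : HasFDerivAt (fun x => fderiv ℝ f x x) (fderiv ℝ f z) z := by
    refine (((hat z hz).differentiableAt (by simp)).hasFDerivAt).congr_of_eventuallyEq ?_
    filter_upwards [isOpen_compl_singleton.mem_nhds hz] with x hx using euler x hx
  have h3 := congrArg (fun L => L v) (h1.unique h2)
  rw [hbil_eq (hat z hz)]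
  simpa using h3

end SliceLemmas

section NormHessian

variable {E : Type*} [NormedAddCommGroup E] [InnerProductSpace ℝ E]

open Filter Topology

lemma hbil_norm {z : E} (hz : ‖z‖ = 1) (v w : E) :
    hbil (fun x : E => ‖x‖) z v w = ⟪v, w⟫ - ⟪z, v⟫ * ⟪z, w⟫ := by
  have hne : z ≠ 0 := by rintro rfl; simp at hz
  have hd : ∀ x : E, x ≠ 0 → HasFDerivAt (fun x : E => ‖x‖) (‖x‖⁻¹ • innerSL ℝ x) x := by
    intro x hx
    have h1 := (hasStrictFDerivAt_norm_sq x).hasFDerivAt.sqrt (by positivity)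
    have h2 : (fun x : E => √(‖x‖ ^ 2)) = fun x => ‖x‖ := by
      ext y; exact Real.sqrt_sq (norm_nonneg y)
    rw [h2, Real.sqrt_sq (norm_nonneg x)] at h1
    convert h1 using 1
    ext y
    simp
    ring
  have heq : (fun x => fderiv ℝ (fun x : E => ‖x‖) x w) =ᶠ[𝓝 z] fun x => ‖x‖⁻¹ * ⟪x, w⟫ := by
    filter_upwards [isOpen_compl_singleton.mem_nhds hne] with x hx
    rw [(hd x hx).fderiv]
    simp
  have h1 : HasFDerivAt (fun x : E => ⟪x, w⟫) ((innerSL ℝ).flip w) z :=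
    ((innerSL ℝ).flip w).hasFDerivAt
  have h2 := ((hasDerivAt_inv (by rw [hz]; norm_num)).comp_hasFDerivAt z (hd z hne)).mul h1
  rw [hbil, heq.fderiv_eq]
  have h3 : fderiv ℝ (fun x : E => ‖x‖⁻¹ * ⟪x, w⟫) z = _ := h2.fderiv
  rw [h3]
  have h4 : (innerSL ℝ).flip w v = ⟪v, w⟫ := rfl
  simp only [add_apply, smul_apply, h4]
  simp [hz]
  ring

end NormHessian

section RadiiMatrix

open Filter Topology
open scoped Matrix

variable {n : ℕ}

/-- The matrix of second derivatives of `f` at `z` in the standard basis. -/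
def hessMat (n : ℕ) (f : ES n → ℝ) (z : ES n) : Matrix (Fin (n + 1)) (Fin (n + 1)) ℝ :=
  Matrix.of fun i j => hbil f z (EuclideanSpace.single i 1) (EuclideanSpace.single j 1)

/-- The matrix `D²f(z) + z ⊗ z`, whose determinant is `suppHessDet`. -/
def radiiMat (n : ℕ) (f : ES n → ℝ) (z : ES n) : Matrix (Fin (n + 1)) (Fin (n + 1)) ℝ :=
  hessMat n f z + Matrix.vecMulVec z.ofLp z.ofLp

lemma suppHessDet_eq_det_radiiMat (f : ES n → ℝ) (z : ES n) :
    suppHessDet n f z = (radiiMat n f z).det := by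
  refine congrArg Matrix.det ?_
  ext i j
  simp [radiiMat, hessMat, Matrix.vecMulVec_apply, EuclideanSpace.inner_single_right]

/-- A positively 1-homogeneous function which is `C²` away from the origin. -/
structure IsHomogC2 (f : ES n → ℝ) : Prop where
  hom : ∀ c : ℝ, 0 < c → ∀ x, x ≠ 0 → f (c • x) = c * f x
  smooth : ContDiffOn ℝ 2 f {(0 : ES n)}ᶜ

lemma IsHomogC2.contDiffAt {f : ES n → ℝ} (hf : IsHomogC2 f) {x : ES n} (hx : x ≠ 0) :
    ContDiffAt ℝ 2 f x :=
  hf.smooth.contDiffAt (isOpen_compl_singleton.mem_nhds hx)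

lemma isHomogC2_norm : IsHomogC2 (fun x : ES n => ‖x‖) where
  hom c hc x _ := by rw [norm_smul, Real.norm_of_nonneg hc.le]
  smooth x hx := (contDiffAt_norm ℝ hx).contDiffWithinAt

lemma IsHomogC2.sub {f g : ES n → ℝ} (hf : IsHomogC2 f) (hg : IsHomogC2 g) :
    IsHomogC2 (fun x => f x - g x) where
  hom c hc x hx := by simp only [hf.hom c hc x hx, hg.hom c hc x hx]; ring
  smooth := hf.smooth.sub hg.smooth

lemma IsHomogC2.const_mul {f : ES n → ℝ} (hf : IsHomogC2 f) (a : ℝ) :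
    IsHomogC2 (fun x => a * f x) where
  hom c hc x hx := by simp only [hf.hom c hc x hx]; ring
  smooth := contDiffOn_const.mul hf.smooth

lemma ne_zero_of_mem_sph {z : ES n} (hz : z ∈ Sph n) : z ≠ 0 := by
  rintro rfl
  simp [Sph] at hz

lemma norm_of_mem_sph {z : ES n} (hz : z ∈ Sph n) : ‖z‖ = 1 := by simpa [Sph] using hz

lemma dotProduct_self_of_mem_sph {z : ES n} (hz : z ∈ Sph n) : z.ofLp ⬝ᵥ z.ofLp = 1 := by
  have h := real_inner_self_eq_norm_sq z
  rw [norm_of_mem_sph hz, EuclideanSpace.inner_eq_star_dotProduct] at h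
  simpa using h

lemma hessMat_sub {f g : ES n → ℝ} (hf : IsHomogC2 f) (hg : IsHomogC2 g) {z : ES n}
    (hz : z ∈ Sph n) : hessMat n (fun x => f x - g x) z = hessMat n f z - hessMat n g z := by
  ext i j
  have hz0 := ne_zero_of_mem_sph hz
  exact hbil_sub (hf.contDiffAt hz0) (hg.contDiffAt hz0) _ _

lemma hessMat_const_mul {f : ES n → ℝ} (hf : IsHomogC2 f) (c : ℝ) {z : ES n}
    (hz : z ∈ Sph n) : hessMat n (fun x => c * f x) z = c • hessMat n f z := by
  ext i j
  exact hbil_const_mul (hf.contDiffAt (ne_zero_of_mem_sph hz)) _ _ _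

lemma hessMat_norm {z : ES n} (hz : z ∈ Sph n) :
    hessMat n (fun x => ‖x‖) z = 1 - Matrix.vecMulVec z.ofLp z.ofLp := by
  ext i j
  simp [hessMat, hbil_norm (norm_of_mem_sph hz), Matrix.vecMulVec_apply, Matrix.one_apply,
    EuclideanSpace.inner_single_right, eq_comm]

lemma eq_sum_smul_single (y : ES n) : y = ∑ j, y j • EuclideanSpace.single j (1 : ℝ) := by
  ext k
  simp [Pi.single_apply]

lemma hessMat_mulVec {f : ES n → ℝ} {z : ES n} (hf : ContDiffAt ℝ 2 f z) (y : ES n) :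
    hessMat n f z *ᵥ y.ofLp = fun i => hbil f z (EuclideanSpace.single i 1) y := by
  ext i
  have hy := eq_sum_smul_single y
  rw [hbil_eq hf]
  conv_rhs => rw [hy]
  rw [map_sum]
  simp only [Matrix.mulVec, dotProduct, hessMat, Matrix.of_apply, map_smul, smul_eq_mul,
    hbil_eq hf]
  exact Finset.sum_congr rfl fun j _ => mul_comm _ _

lemma hessMat_isHermitian {f : ES n → ℝ} {z : ES n} (hf : ContDiffAt ℝ 2 f z) :
    (hessMat n f z).IsHermitian := by
  ext i j
  simpa [hessMat] using hbil_comm hf _ _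

lemma dotProduct_hessMat_mulVec {f : ES n → ℝ} {z : ES n} (hf : ContDiffAt ℝ 2 f z)
    (x y : ES n) : x.ofLp ⬝ᵥ (hessMat n f z *ᵥ y.ofLp) = hbil f z x y := by
  have h : x.ofLp ⬝ᵥ (hessMat n f z *ᵥ y.ofLp) = y.ofLp ⬝ᵥ (hessMat n f z *ᵥ x.ofLp) := by
    rw [Matrix.dotProduct_mulVec, ← Matrix.mulVec_transpose, dotProduct_comm]
    congr 2
    simpa using (hessMat_isHermitian hf).eq
  have hy := eq_sum_smul_single y
  rw [h, hessMat_mulVec hf, hbil_comm hf, hbil_eq hf]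
  conv_rhs => rw [hy]
  rw [map_sum]
  simp [dotProduct, hbil_eq hf]

lemma IsHomogC2.radiiMat_mulVec_self {f : ES n → ℝ} (hf : IsHomogC2 f) {z : ES n}
    (hz : z ∈ Sph n) : radiiMat n f z *ᵥ z.ofLp = z.ofLp := by
  have hz0 := ne_zero_of_mem_sph hz
  rw [radiiMat, Matrix.add_mulVec, hessMat_mulVec (hf.contDiffAt hz0), Matrix.vecMulVec_mulVec,
    dotProduct_self_of_mem_sph hz]
  ext i
  simp [hbil_self_right_of_homogeneous hz0 hf.smooth hf.hom]

lemma radiiMat_isHermitian {f : ES n → ℝ} {z : ES n} (hf : ContDiffAt ℝ 2 f z) :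
    (radiiMat n f z).IsHermitian := by
  refine (hessMat_isHermitian hf).add ?_
  simpa using (Matrix.posSemidef_vecMulVec_self_star z.ofLp).isHermitian

lemma IsHomogC2.radiiMat_posDef {f : ES n → ℝ} (hf : IsHomogC2 f) {z : ES n} (hz : z ∈ Sph n)
    (hconv : ∀ v : ES n, ⟪v, z⟫ = 0 → v ≠ 0 → 0 < hbil f z v v) : (radiiMat n f z).PosDef := by
  have hz0 := ne_zero_of_mem_sph hz
  have hc := hf.contDiffAt hz0
  refine Matrix.PosDef.of_dotProduct_mulVec_pos (radiiMat_isHermitian hc) fun x hx => ?_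
  set X : ES n := WithLp.toLp 2 x with hX
  have hXx : X.ofLp = x := rfl
  set a : ℝ := ⟪X, z⟫ with ha
  have hzz : ⟪z, z⟫ = (1 : ℝ) := by rw [real_inner_self_eq_norm_sq, norm_of_mem_sph hz]; norm_num
  set v : ES n := X - a • z with hv
  have hvz : ⟪v, z⟫ = (0 : ℝ) := by
    rw [hv, inner_sub_left, inner_smul_left, hzz, ← ha]; simp
  have hquad : star x ⬝ᵥ (radiiMat n f z *ᵥ x) = hbil f z v v + a ^ 2 := by
    have h1 : x ⬝ᵥ z.ofLp = a := by
      rw [ha, EuclideanSpace.inner_eq_star_dotProduct, dotProduct_comm]; simp [hX]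
    have h2 : hbil f z X X = hbil f z v v := by
      have hr : ∀ w, fderiv ℝ (fderiv ℝ f) z w z = 0 := fun w => by
        rw [← hbil_eq hc]; exact hbil_self_right_of_homogeneous hz0 hf.smooth hf.hom w
      have hl : ∀ w, fderiv ℝ (fderiv ℝ f) z z w = 0 := fun w => by
        rw [← hbil_eq hc, hbil_comm hc]
        exact hbil_self_right_of_homogeneous hz0 hf.smooth hf.hom w
      simp [hbil_eq hc, hv, hr, hl]
    rw [star_trivial, radiiMat, Matrix.add_mulVec, dotProduct_add, ← hXx,
      dotProduct_hessMat_mulVec hc, Matrix.vecMulVec_mulVec, h2, dotProduct_comm z.ofLp, hXx, h1]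
    simp [dotProduct_smul, h1]
    ring
  rw [hquad]
  by_cases hv0 : v = 0
  · have ha0 : a ≠ 0 := by
      intro h0
      have : X = 0 := by
        have h3 : X = v + a • z := by simp [hv]
        rw [h3, hv0, h0]; simp
      exact hx (by rw [← hXx, this]; rfl)
    have h4 : hbil f z v v = 0 := by rw [hbil_eq hc, hv0]; simp
    rw [h4]
    positivity
  · have := hconv v hvz hv0
    positivity

lemma IsHomogC2.hessMat_posSemidef {g : ES n → ℝ} (hg : IsHomogC2 g) {z : ES n} (hz : z ∈ Sph n)
    (hpos : ∀ y ∈ Sph n, 0 ≤ g y) (h0 : g z = 0) : (hessMat n g z).PosSemidef := by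
  have hz0 := ne_zero_of_mem_sph hz
  have hc := hg.contDiffAt hz0
  have hmin : IsLocalMin g z := by
    filter_upwards [isOpen_compl_singleton.mem_nhds hz0] with x hx
    have hx0 : 0 < ‖x‖ := norm_pos_iff.2 hx
    have h1 : g x = ‖x‖ * g (‖x‖⁻¹ • x) := by
      rw [← hg.hom _ hx0 _ (smul_ne_zero (inv_ne_zero hx0.ne') hx), smul_smul,
        mul_inv_cancel₀ hx0.ne', one_smul]
    rw [h0, h1]
    refine mul_nonneg hx0.le (hpos _ ?_)
    simp [Sph, norm_smul, hx0.ne']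
  refine Matrix.PosSemidef.of_dotProduct_mulVec_nonneg (hessMat_isHermitian hc) fun x => ?_
  have h := dotProduct_hessMat_mulVec hc (WithLp.toLp 2 x) (WithLp.toLp 2 x)
  rw [star_trivial]
  exact h ▸ hbil_self_nonneg_of_isLocalMin hc hmin _

lemma trace_inv_radiiMat_mul_hessMat {f : ES n → ℝ} (hf : IsHomogC2 f) {z : ES n} (hz : z ∈ Sph n)
    (hA : (radiiMat n f z).PosDef) : ((radiiMat n f z)⁻¹ * hessMat n f z).trace = n := by
  have h : hessMat n f z = radiiMat n f z - Matrix.vecMulVec z.ofLp z.ofLp := by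
    simp [radiiMat]
  rw [h, Matrix.mul_sub, Matrix.nonsing_inv_mul _ hA.det_pos.ne'.isUnit, Matrix.trace_sub,
    trace_inv_mul_vecMulVec hA (hf.radiiMat_mulVec_self hz) (dotProduct_self_of_mem_sph hz),
    Matrix.trace_one]
  simp

lemma trace_inv_radiiMat_mul_hessMat_norm {f : ES n → ℝ} (hf : IsHomogC2 f) {z : ES n}
    (hz : z ∈ Sph n) (hA : (radiiMat n f z).PosDef) :
    ((radiiMat n f z)⁻¹ * hessMat n (fun x => ‖x‖) z).trace = (radiiMat n f z)⁻¹.trace - 1 := by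
  rw [hessMat_norm hz, Matrix.mul_sub, Matrix.trace_sub, Matrix.mul_one,
    trace_inv_mul_vecMulVec hA (hf.radiiMat_mulVec_self hz) (dotProduct_self_of_mem_sph hz)]

/-- A matrix diagonalised by an orthonormal family of left eigenvectors. -/
lemma posDef_and_det_of_orthonormal {ι : Type*} [Fintype ι] [DecidableEq ι] {A : Matrix ι ι ℝ}
    {e : ι → EuclideanSpace ℝ ι} (he : Orthonormal ℝ e) {d : ι → ℝ} (hd : ∀ i, 0 < d i)
    (h : ∀ i, (e i).ofLp ᵥ* A = d i • (e i).ofLp) : A.PosDef ∧ A.det = ∏ i, d i := by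
  set O : Matrix ι ι ℝ := Matrix.of fun i j => e i j with hO
  have hOO : O * Oᵀ = 1 := by
    ext i j
    have h1 := orthonormal_iff_ite.1 he j i
    rw [EuclideanSpace.inner_eq_star_dotProduct] at h1
    simpa [hO, Matrix.mul_apply, dotProduct, Matrix.one_apply, eq_comm] using h1
  have hOO' : Oᵀ * O = 1 := mul_eq_one_comm.1 hOO
  have hOA : O * A = Matrix.diagonal d * O := by
    ext i j
    have h1 := congrFun (h i) j
    simpa [hO, Matrix.mul_apply, Matrix.vecMul, dotProduct, Matrix.diagonal_apply] using h1
  have hA : A = Oᵀ * Matrix.diagonal d * O := by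
    rw [Matrix.mul_assoc, ← hOA, ← Matrix.mul_assoc, hOO', Matrix.one_mul]
  have hdet : A.det = ∏ i, d i := by
    rw [hA, Matrix.det_mul, Matrix.det_mul, Matrix.det_diagonal, mul_right_comm,
      ← Matrix.det_mul, hOO', Matrix.det_one, one_mul]
  refine ⟨?_, hdet⟩
  have h1 : A.PosSemidef := by
    rw [hA]
    simpa using (Matrix.PosSemidef.diagonal (fun i => (hd i).le)).conjTranspose_mul_mul_same O
  rw [h1.posDef_iff_det_ne_zero, hdet]
  exact (Finset.prod_pos fun i _ => hd i).ne'

end RadiiMatrix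

section PenalizedFlow

open Filter Topology Set
open scoped Matrix

lemma deriv_nonneg_of_forall_le_left {f : ℝ → ℝ} {f' a b : ℝ} (hab : a < b)
    (hf : HasDerivAt f f' b) (h : ∀ s, a ≤ s → s ≤ b → f s ≤ f b) : 0 ≤ f' := by
  have h1 : Tendsto (slope f b) (𝓝[<] b) (𝓝 f') :=
    hf.tendsto_slope.mono_left (nhdsWithin_mono _ fun x hx => ne_of_lt hx)
  refine ge_of_tendsto h1 ?_
  filter_upwards [Ioo_mem_nhdsLT hab] with s hs
  rw [slope_def_field]
  exact div_nonneg_of_nonpos (sub_nonpos.2 (h s hs.1.le hs.2.le)) (sub_nonpos.2 hs.2.le)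

lemma Penalty.nonpos {δ C₀ : ℝ} (P : Penalty δ C₀) (x : ℝ) : P.β x ≤ 0 :=
  (P.mono (le_max_left x δ)).trans (P.zero_of_ge _ (le_max_right x δ)).le

lemma Penalty.hasDerivAt {δ C₀ : ℝ} (P : Penalty δ C₀) (x : ℝ) :
    HasDerivAt P.β (deriv P.β x) x :=
  (P.smooth.differentiable (by simp) x).hasDerivAt

lemma sph_isCompact (n : ℕ) : IsCompact (Sph n) := isCompact_sphere 0 1

lemma bddAbove_image_sph {n : ℕ} {f : ES n → ℝ} (hf : ContinuousOn f (Sph n)) :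
    BddAbove {y : ℝ | ∃ z ∈ Sph n, y = f z} := by
  obtain ⟨b, hb⟩ := (sph_isCompact n).bddAbove_image hf
  refine ⟨b, ?_⟩
  rintro y ⟨z, hz, rfl⟩
  exact hb ⟨z, hz, rfl⟩

lemma sph_prod_subset {n : ℕ} {I J : Set ℝ} (h : I ⊆ J) :
    Sph n ×ˢ I ⊆ ({(0 : ES n)}ᶜ : Set (ES n)) ×ˢ J :=
  prod_mono (fun _ hz => ne_zero_of_mem_sph hz) h

namespace ShrinkingObstacle

variable {n : ℕ} (Φ : ShrinkingObstacle n)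

lemma isHomogC2 {t : ℝ} (ht : 0 ≤ t) : IsHomogC2 (fun x => Φ.φ x t) where
  hom c hc x _ := Φ.homog t ht c hc x
  smooth := (contDiffOn_slice Φ.smooth (show t ∈ Ici (0 : ℝ) from ht)).of_le (by norm_num)

lemma continuousOn : ContinuousOn (fun p : ES n × ℝ => Φ.φ p.1 p.2)
    (({(0 : ES n)}ᶜ : Set (ES n)) ×ˢ Ici 0) := Φ.smooth.continuousOn

lemma radiiMat_posDef_and_det {z : ES n} (hz : z ∈ Sph n) {t : ℝ} (ht : 0 ≤ t) :
    (radiiMat n (fun x => Φ.φ x t) z).PosDef ∧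
      (radiiMat n (fun x => Φ.φ x t) z).det = (∏ i, Φ.μ i z t)⁻¹ := by
  obtain ⟨e, he, hez, hee⟩ := Φ.μ_eigen z hz t ht
  have hz0 := ne_zero_of_mem_sph hz
  have hh := Φ.isHomogC2 ht
  have hc := hh.contDiffAt hz0
  have hzn := norm_of_mem_sph hz
  have horth : Orthonormal ℝ (Fin.cons z e : Fin (n + 1) → ES n) := by
    constructor
    · intro i
      refine Fin.cases ?_ (fun i => ?_) i
      · simpa using hzn
      · simpa using he.1 i
    · intro i j hij
      induction i using Fin.cases with
      | zero =>
        induction j using Fin.cases with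
        | zero => exact absurd rfl hij
        | succ j =>
          simp only [Fin.cons_zero, Fin.cons_succ]
          rw [real_inner_comm]; exact hez j
      | succ i =>
        induction j using Fin.cases with
        | zero => simpa using hez i
        | succ j => simpa using he.2 (fun h => hij (by rw [h]))
  have hleft : ∀ y : ES n, ∀ d : ℝ,
      (∀ v, hbil (fun x => Φ.φ x t) z y v + ⟪y, z⟫ * ⟪z, v⟫ = d * ⟪y, v⟫) →
      y.ofLp ᵥ* radiiMat n (fun x => Φ.φ x t) z = d • y.ofLp := by
    intro y d h
    have hsymm : (radiiMat n (fun x => Φ.φ x t) z)ᵀ = radiiMat n (fun x => Φ.φ x t) z := by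
      simpa using (radiiMat_isHermitian hc).eq
    rw [← Matrix.mulVec_transpose, hsymm, radiiMat, Matrix.add_mulVec, hessMat_mulVec hc,
      Matrix.vecMulVec_mulVec]
    ext j
    have h1 := h (EuclideanSpace.single j 1)
    rw [hbil_comm hc, EuclideanSpace.inner_eq_star_dotProduct y z] at h1
    simp only [EuclideanSpace.inner_single_right, star_trivial] at h1
    simpa [mul_comm] using h1
  have hmain := posDef_and_det_of_orthonormal horth
    (d := Fin.cons 1 fun i => (Φ.μ i z t)⁻¹) (A := radiiMat n (fun x => Φ.φ x t) z)
    (fun i => by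
      refine Fin.cases ?_ (fun i => ?_) i
      · simp
      · simpa using Φ.μ_pos i z hz t ht)
    (fun i => by
      refine Fin.cases ?_ (fun i => ?_) i
      · simp only [Fin.cons_zero]
        refine hleft _ _ fun v => ?_
        rw [hbil_comm hc, hbil_self_right_of_homogeneous hz0 hh.smooth hh.hom,
          real_inner_self_eq_norm_sq, hzn]
        ring
      · simp only [Fin.cons_succ]
        refine hleft _ _ fun v => ?_
        rw [hee, hez]
        ring)
  refine ⟨hmain.1, hmain.2.trans ?_⟩
  rw [Fin.prod_univ_succ]
  simp

lemma rpow_prod_le_of_penaltyConst {α C₀ : ℝ} (hα : 0 < α) (hC₀ : PenaltyConst n α Φ C₀)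
    {z : ES n} (hz : z ∈ Sph n) {t : ℝ} (ht : 0 ≤ t) : (∏ i, Φ.μ i z t) ^ α ≤ C₀ := by
  obtain ⟨M, hM⟩ := Φ.μ_bdd
  rw [hC₀]
  refine le_csSup ⟨(M ^ n) ^ α, ?_⟩ ⟨z, hz, t, ht, rfl⟩
  rintro y ⟨z, hz, t, ht, rfl⟩
  refine Real.rpow_le_rpow (Finset.prod_nonneg fun i _ => (Φ.μ_pos i z hz t ht).le) ?_ hα.le
  calc ∏ i, Φ.μ i z t ≤ ∏ _i : Fin n, M :=
        Finset.prod_le_prod (fun i _ => (Φ.μ_pos i z hz t ht).le) fun i _ => hM i z hz t ht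
    _ = M ^ n := by simp

end ShrinkingObstacle

namespace IsPenalizedSol

variable {n : ℕ} {α T δ C₀ : ℝ} {Φ : ShrinkingObstacle n} {P : Penalty δ C₀}
  {u : ES n → ℝ → ℝ}

lemma isHomogC2 (hu : IsPenalizedSol n α T δ C₀ Φ P u) {t : ℝ} (ht : t ∈ Ico 0 T) :
    IsHomogC2 (fun x => u x t) where
  hom c hc x _ := hu.homog t ht c hc x
  smooth := (contDiffOn_slice hu.smooth ht).of_le (WithTop.coe_le_coe.2 (le_top : (2 : ℕ∞) ≤ ⊤))

lemma contDiffOn_derivWithin (hu : IsPenalizedSol n α T δ C₀ Φ P u) :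
    ContDiffOn ℝ (⊤ : ℕ∞) (fun p : ES n × ℝ => derivWithin (u p.1) (Ico 0 T) p.2)
      (({(0 : ES n)}ᶜ : Set (ES n)) ×ˢ Ico 0 T) :=
  contDiffOn_derivWithin_slice isOpen_compl_singleton (uniqueDiffOn_Ico 0 T) hu.smooth

lemma isHomogC2_derivWithin (hu : IsPenalizedSol n α T δ C₀ Φ P u) {t : ℝ} (ht : t ∈ Ico 0 T) :
    IsHomogC2 (fun x => derivWithin (u x) (Ico 0 T) t) where
  hom c hc x _ := by
    rw [derivWithin_congr (fun s hs => hu.homog s hs c hc x) (hu.homog t ht c hc x)]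
    exact derivWithin_const_mul_field c
  smooth := (contDiffOn_slice (f := fun x t => derivWithin (u x) (Ico 0 T) t)
    hu.contDiffOn_derivWithin ht).of_le (WithTop.coe_le_coe.2 (le_top : (2 : ℕ∞) ≤ ⊤))

lemma hasDerivWithinAt (hu : IsPenalizedSol n α T δ C₀ Φ P u) {z : ES n} (hz : z ∈ Sph n)
    {t : ℝ} (ht : t ∈ Ico 0 T) :
    HasDerivWithinAt (u z) (derivWithin (u z) (Ico 0 T) t) (Ico 0 T) t := by
  have hz0 := ne_zero_of_mem_sph hz
  have h := hasDerivWithinAt_slice (f := u) (U := {(0 : ES n)}ᶜ) hz0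
    (hu.smooth.differentiableOn (by simp) (z, t) ⟨hz0, ht⟩)
  exact h.differentiableWithinAt.hasDerivWithinAt

lemma radiiMat_posDef (hu : IsPenalizedSol n α T δ C₀ Φ P u) {z : ES n} (hz : z ∈ Sph n)
    {t : ℝ} (ht : t ∈ Ico 0 T) : (radiiMat n (fun x => u x t) z).PosDef :=
  (hu.isHomogC2 ht).radiiMat_posDef hz (hu.strict_convex t ht z hz)

lemma continuousOn_radiiMat (hu : IsPenalizedSol n α T δ C₀ Φ P u) :
    ContinuousOn (fun p : ES n × ℝ => radiiMat n (fun x => u x p.2) p.1)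
      (Sph n ×ˢ Ico 0 T) := by
  refine continuousOn_pi.2 fun i => continuousOn_pi.2 fun j => ?_
  have h1 := (contDiffOn_hbil_slice isOpen_compl_singleton (uniqueDiffOn_Ico 0 T) hu.smooth
    (EuclideanSpace.single i 1) (EuclideanSpace.single j 1)).continuousOn.mono
      (sph_prod_subset Subset.rfl)
  refine h1.add ?_
  have h2 : Continuous fun p : ES n × ℝ => p.1 i * p.1 j := by fun_prop
  exact h2.continuousOn

lemma continuousOn_det (hu : IsPenalizedSol n α T δ C₀ Φ P u) :
    ContinuousOn (fun p : ES n × ℝ => (radiiMat n (fun x => u x p.2) p.1).det)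
      (Sph n ×ˢ Ico 0 T) :=
  (continuous_id.matrix_det).comp_continuousOn hu.continuousOn_radiiMat

lemma continuousOn_derivWithin (hu : IsPenalizedSol n α T δ C₀ Φ P u) :
    ContinuousOn (fun p : ES n × ℝ => derivWithin (u p.1) (Ico 0 T) p.2) (Sph n ×ˢ Ico 0 T) :=
  hu.contDiffOn_derivWithin.continuousOn.mono (sph_prod_subset Subset.rfl)

lemma continuousOn (hu : IsPenalizedSol n α T δ C₀ Φ P u) :
    ContinuousOn (fun p : ES n × ℝ => u p.1 p.2) (Sph n ×ˢ Ico 0 T) :=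
  hu.smooth.continuousOn.mono (sph_prod_subset Subset.rfl)

lemma continuousOn_obstacle :
    ContinuousOn (fun p : ES n × ℝ => Φ.φ p.1 p.2) (Sph n ×ˢ Ico 0 T) :=
  Φ.continuousOn.mono (sph_prod_subset fun _ h => h.1)

lemma derivWithin_eq_interior (hu : IsPenalizedSol n α T δ C₀ Φ P u) {z : ES n}
    (hz : z ∈ Sph n) {t : ℝ} (ht : t ∈ Ioo 0 T) :
    derivWithin (u z) (Ico 0 T) t =
      -((radiiMat n (fun x => u x t) z).det ^ (-α)) - P.β (u z t - Φ.φ z t) := by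
  rw [derivWithin_of_mem_nhds (Ico_mem_nhds ht.1 ht.2), (hu.eqn z hz t ht).deriv,
    suppHessDet_eq_det_radiiMat]

lemma derivWithin_eq (hT : 0 < T) (hu : IsPenalizedSol n α T δ C₀ Φ P u) {z : ES n}
    (hz : z ∈ Sph n) {t : ℝ} (ht : t ∈ Ico 0 T) :
    derivWithin (u z) (Ico 0 T) t =
      -((radiiMat n (fun x => u x t) z).det ^ (-α)) - P.β (u z t - Φ.φ z t) := by
  have hmk : ContinuousOn (fun s : ℝ => (z, s)) (Ico 0 T) := by fun_prop
  have hmaps : MapsTo (fun s : ℝ => (z, s)) (Ico 0 T) (Sph n ×ˢ Ico 0 T) := fun s hs => ⟨hz, hs⟩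
  have heq : EqOn (fun t => derivWithin (u z) (Ico 0 T) t)
      (fun t => -((radiiMat n (fun x => u x t) z).det ^ (-α)) - P.β (u z t - Φ.φ z t))
      (Ico 0 T) := by
    refine EqOn.of_subset_closure (s := Ioo 0 T) (fun s hs => hu.derivWithin_eq_interior hz hs)
      (hu.continuousOn_derivWithin.comp hmk hmaps) ?_ Ioo_subset_Ico_self ?_
    · refine ContinuousOn.sub (ContinuousOn.neg ?_) ?_
      · exact (hu.continuousOn_det.comp hmk hmaps).rpow_const fun s hs =>
          Or.inl (hu.radiiMat_posDef hz hs).det_pos.ne'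
      · exact P.smooth.continuous.comp_continuousOn
          ((hu.continuousOn.comp hmk hmaps).sub (continuousOn_obstacle.comp hmk hmaps))
    · rw [closure_Ioo hT.ne]
      exact Ico_subset_Icc_self
  exact heq ht

/-- The evolution equation of the speed. -/
lemma hasDerivAt_derivWithin (hT : 0 < T) (hu : IsPenalizedSol n α T δ C₀ Φ P u) {z : ES n}
    (hz : z ∈ Sph n) {t : ℝ} (ht : t ∈ Ioo 0 T) :
    HasDerivAt (derivWithin (u z) (Ico 0 T))
      (α * (radiiMat n (fun x => u x t) z).det ^ (-α) *
          ((radiiMat n (fun x => u x t) z)⁻¹ *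
            hessMat n (fun x => derivWithin (u x) (Ico 0 T) t) z).trace -
        deriv P.β (u z t - Φ.φ z t) * (derivWithin (u z) (Ico 0 T) t - Φ.φt z t)) t := by
  have hz0 := ne_zero_of_mem_sph hz
  have hev : ∀ᶠ s in 𝓝 t, s ∈ Ico 0 T := Ico_mem_nhds ht.1 ht.2
  have htI : t ∈ interior (Ico 0 T) := by rw [interior_Ico]; exact ht
  have ht' : t ∈ Ico 0 T := Ioo_subset_Ico_self ht
  have hpos := (hu.radiiMat_posDef hz ht').det_pos
  have hdet : HasDerivAt (fun s => (radiiMat n (fun x => u x s) z).det)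
      ((radiiMat n (fun x => u x t) z).det * ((radiiMat n (fun x => u x t) z)⁻¹ *
            hessMat n (fun x => derivWithin (u x) (Ico 0 T) t) z).trace) t := by
    refine hasDerivAt_det (hev.mono fun s hs => hu.radiiMat_posDef hz hs) fun i j => ?_
    exact (hasDerivAt_hbil_slice isOpen_compl_singleton (uniqueDiffOn_Ico 0 T) hz0 htI
      hu.smooth _ _).add_const _
  have hud : HasDerivAt (u z) (derivWithin (u z) (Ico 0 T) t) t :=
    (hu.hasDerivWithinAt hz ht').hasDerivAt (Ico_mem_nhds ht.1 ht.2)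
  have hβ := (P.hasDerivAt (u z t - Φ.φ z t)).comp t (hud.sub (Φ.hφt z hz t ht.1.le))
  have hall := ((hdet.rpow_const (p := -α) (Or.inl hpos.ne')).neg).sub hβ
  refine (hall.congr_of_eventuallyEq ?_).congr_deriv ?_
  · filter_upwards [hev] with s hs
    exact hu.derivWithin_eq hT hz hs
  · rw [Real.rpow_sub_one hpos.ne']
    field_simp

/-- The solution never touches the obstacle. -/
lemma obstacle_lt (hα : 0 < α) (hu : IsPenalizedSol n α T δ C₀ Φ P u)
    (hC₀ : PenaltyConst n α Φ C₀) (h0 : ∀ z ∈ Sph n, Φ.φ z 0 < u z 0)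
    {z : ES n} (hz : z ∈ Sph n) {t : ℝ} (ht : t ∈ Ico 0 T) : Φ.φ z t < u z t := by
  by_contra! hle
  have hsub : Sph n ×ˢ Icc 0 t ⊆ Sph n ×ˢ Ico 0 T :=
    prod_mono Subset.rfl fun s hs => ⟨hs.1, hs.2.trans_lt ht.2⟩
  set K : Set (ES n × ℝ) := (Sph n ×ˢ Icc 0 t) ∩ {p | u p.1 p.2 - Φ.φ p.1 p.2 ≤ 0} with hK
  have hcont : ContinuousOn (fun p : ES n × ℝ => u p.1 p.2 - Φ.φ p.1 p.2) (Sph n ×ˢ Ico 0 T) :=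
    hu.continuousOn.sub continuousOn_obstacle
  have hKc : IsCompact K := by
    have hbase : IsCompact (Sph n ×ˢ Icc 0 t) := (sph_isCompact n).prod isCompact_Icc
    refine hbase.of_isClosed_subset ?_ inter_subset_left
    exact (hcont.mono hsub).preimage_isClosed_of_isClosed hbase.isClosed isClosed_Iic
  have hKne : K.Nonempty := ⟨(z, t), ⟨hz, ht.1, le_rfl⟩, sub_nonpos.2 hle⟩
  obtain ⟨⟨z₀, t₀⟩, ⟨⟨hz₀, ht₀⟩, hle₀⟩, hmin⟩ := hKc.exists_isMinOn hKne continuous_snd.continuousOn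
  simp only at hz₀ ht₀
  have hle₀ : u z₀ t₀ - Φ.φ z₀ t₀ ≤ 0 := hle₀
  have ht₀pos : 0 < t₀ := by
    refine lt_of_le_of_ne ht₀.1 fun h => ?_
    have := h0 z₀ hz₀
    rw [h] at this
    linarith
  have ht₀T : t₀ ∈ Ioo 0 T := ⟨ht₀pos, ht₀.2.trans_lt ht.2⟩
  have hbefore : ∀ y ∈ Sph n, ∀ s ∈ Ico 0 t₀, 0 < u y s - Φ.φ y s := by
    intro y hy s hs
    by_contra! hcon
    have : t₀ ≤ s := hmin (a := (y, s)) ⟨⟨hy, hs.1, hs.2.le.trans ht₀.2⟩, hcon⟩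
    linarith [hs.2]
  have hnonneg : ∀ y ∈ Sph n, 0 ≤ u y t₀ - Φ.φ y t₀ := by
    intro y hy
    have hmk : ContinuousOn (fun s : ℝ => (y, s)) (Ico 0 T) := by fun_prop
    have h1 : ContinuousOn (fun s => u y s - Φ.φ y s) (Ico 0 T) :=
      hcont.comp hmk fun s hs => ⟨hy, hs⟩
    have h2 : Tendsto (fun s => u y s - Φ.φ y s) (𝓝[<] t₀) (𝓝 (u y t₀ - Φ.φ y t₀)) :=
      (h1.continuousAt (Ico_mem_nhds ht₀T.1 ht₀T.2)).tendsto.mono_left nhdsWithin_le_nhds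
    refine ge_of_tendsto h2 ?_
    filter_upwards [Ioo_mem_nhdsLT ht₀pos] with s hs using (hbefore y hy s ⟨hs.1.le, hs.2⟩).le
  have hzero : u z₀ t₀ - Φ.φ z₀ t₀ = 0 := le_antisymm hle₀ (hnonneg z₀ hz₀)
  have huh := hu.isHomogC2 (Ioo_subset_Ico_self ht₀T)
  have hφh := Φ.isHomogC2 ht₀T.1.le
  have hpsd := (huh.sub hφh).hessMat_posSemidef hz₀ hnonneg hzero
  rw [hessMat_sub huh hφh hz₀] at hpsd
  obtain ⟨hφpos, hφdet⟩ := Φ.radiiMat_posDef_and_det hz₀ ht₀T.1.le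
  have hdet := det_le_det_of_sub_posSemidef (hu.radiiMat_posDef hz₀ (Ioo_subset_Ico_self ht₀T))
    hφpos (by simpa [radiiMat] using hpsd)
  have hK1 : (radiiMat n (fun x => u x t₀) z₀).det ^ (-α) ≤ C₀ := by
    refine le_trans ?_ (Φ.rpow_prod_le_of_penaltyConst hα hC₀ hz₀ ht₀T.1.le)
    refine (Real.rpow_le_rpow_of_nonpos hφpos.det_pos hdet (by linarith)).trans ?_
    have hμ : 0 ≤ ∏ i, Φ.μ i z₀ t₀ :=
      Finset.prod_nonneg fun i _ => (Φ.μ_pos i z₀ hz₀ t₀ ht₀T.1.le).le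
    rw [hφdet, Real.rpow_neg (inv_nonneg.2 hμ), Real.inv_rpow hμ, inv_inv]
  have hud := (hu.hasDerivWithinAt hz₀ (Ioo_subset_Ico_self ht₀T)).hasDerivAt
    (Ico_mem_nhds ht₀T.1 ht₀T.2)
  have hder := deriv_nonneg_of_forall_le_left ht₀pos
    ((Φ.hφt z₀ hz₀ t₀ ht₀T.1.le).sub hud) (by
      intro s hs1 hs2
      simp only [Pi.sub_apply]
      rcases hs2.eq_or_lt with rfl | hlt
      · exact le_rfl
      · linarith [hbefore z₀ hz₀ s ⟨hs1, hlt⟩])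
  rw [hu.derivWithin_eq_interior hz₀ ht₀T, hzero, P.at_zero] at hder
  linarith [Φ.φt_neg z₀ hz₀ t₀ ht₀T.1.le]

/-- The support function is non-increasing in time. -/
lemma derivWithin_nonpos (hT : 0 < T) (hα : 0 < α) (hu : IsPenalizedSol n α T δ C₀ Φ P u)
    (h0 : ∀ z ∈ Sph n, derivWithin (u z) (Ico 0 T) 0 < 0)
    {z : ES n} (hz : z ∈ Sph n) {t : ℝ} (ht : t ∈ Ico 0 T) :
    derivWithin (u z) (Ico 0 T) t ≤ 0 := by
  by_contra! hpos
  have hsub : Sph n ×ˢ Icc 0 t ⊆ Sph n ×ˢ Ico 0 T :=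
    prod_mono Subset.rfl fun s hs => ⟨hs.1, hs.2.trans_lt ht.2⟩
  have hbase : IsCompact (Sph n ×ˢ Icc 0 t) := (sph_isCompact n).prod isCompact_Icc
  have hne : (Sph n ×ˢ Icc 0 t).Nonempty := ⟨(z, t), hz, ht.1, le_rfl⟩
  have hcoef : ContinuousOn (fun p : ES n × ℝ => α * (radiiMat n (fun x => u x p.2) p.1).det ^ (-α) *
      ((radiiMat n (fun x => u x p.2) p.1)⁻¹.trace - 1)) (Sph n ×ˢ Icc 0 t) := by
    refine ContinuousOn.mul (ContinuousOn.mul continuousOn_const ?_)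
      (ContinuousOn.sub ?_ continuousOn_const)
    · exact (hu.continuousOn_det.mono hsub).rpow_const fun p hp =>
        Or.inl (hu.radiiMat_posDef (hsub hp).1 (hsub hp).2).det_pos.ne'
    · intro p hp
      have h1 := continuousAt_matrix_inv (radiiMat n (fun x => u x p.2) p.1) (by
        rw [Ring.inverse_eq_inv']
        exact continuousAt_inv₀ (hu.radiiMat_posDef (hsub hp).1 (hsub hp).2).det_pos.ne')
      have h2 : ContinuousWithinAt (fun p : ES n × ℝ => (radiiMat n (fun x => u x p.2) p.1)⁻¹)
          (Sph n ×ˢ Icc 0 t) p :=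
        ContinuousAt.comp_continuousWithinAt (g := Inv.inv)
          (f := fun p : ES n × ℝ => radiiMat n (fun x => u x p.2) p.1) h1
          ((hu.continuousOn_radiiMat.mono hsub) p hp)
      exact ContinuousAt.comp_continuousWithinAt (g := Matrix.trace)
        (continuous_id.matrix_trace.continuousAt) h2
  obtain ⟨pM, -, hM⟩ := hbase.exists_isMaxOn hne hcoef
  set M : ℝ := α * (radiiMat n (fun x => u x pM.2) pM.1).det ^ (-α) *
      ((radiiMat n (fun x => u x pM.2) pM.1)⁻¹.trace - 1) with hMdef
  have hg : ContinuousOn (fun p : ES n × ℝ =>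
      derivWithin (u p.1) (Ico 0 T) p.2 * Real.exp (-(M + 1) * p.2)) (Sph n ×ˢ Icc 0 t) := by
    refine (hu.continuousOn_derivWithin.mono hsub).mul ?_
    have : Continuous fun p : ES n × ℝ => Real.exp (-(M + 1) * p.2) := by fun_prop
    exact this.continuousOn
  obtain ⟨⟨z₀, t₀⟩, ⟨hz₀, ht₀⟩, hmax⟩ := hbase.exists_isMaxOn hne hg
  simp only at hz₀ ht₀
  set c : ℝ := derivWithin (u z₀) (Ico 0 T) t₀ with hc
  have hmax' : ∀ y ∈ Sph n, ∀ s ∈ Icc 0 t,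
      derivWithin (u y) (Ico 0 T) s * Real.exp (-(M + 1) * s) ≤ c * Real.exp (-(M + 1) * t₀) :=
    fun y hy s hs => hmax (a := (y, s)) ⟨hy, hs⟩
  have hcpos : 0 < c := by
    have h1 := hmax' z hz t ⟨ht.1, le_rfl⟩
    have h2 : 0 < c * Real.exp (-(M + 1) * t₀) := lt_of_lt_of_le (by positivity) h1
    exact pos_of_mul_pos_left h2 (Real.exp_pos _).le
  have ht₀pos : 0 < t₀ := by
    refine lt_of_le_of_ne ht₀.1 fun h => ?_
    have h1 := h0 z₀ hz₀
    rw [hc, ← h] at hcpos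
    linarith
  have ht₀T : t₀ ∈ Ioo 0 T := ⟨ht₀pos, ht₀.2.trans_lt ht.2⟩
  have ht₀I := Ioo_subset_Ico_self ht₀T
  have huh := hu.isHomogC2 ht₀I
  have hWh := hu.isHomogC2_derivWithin ht₀I
  have hA := hu.radiiMat_posDef hz₀ ht₀I
  have hpsd := ((isHomogC2_norm.const_mul c).sub hWh).hessMat_posSemidef hz₀ (by
      intro y hy
      have h1 := hmax' y hy t₀ ht₀
      have h2 := le_of_mul_le_mul_right h1 (Real.exp_pos _)
      rw [norm_of_mem_sph hy]
      linarith) (by rw [norm_of_mem_sph hz₀, ← hc]; ring)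
  rw [hessMat_sub (isHomogC2_norm.const_mul c) hWh hz₀,
    hessMat_const_mul isHomogC2_norm c hz₀] at hpsd
  have htr := trace_inv_mul_nonneg hA hpsd
  rw [Matrix.mul_sub, Matrix.mul_smul, Matrix.trace_sub, Matrix.trace_smul,
    trace_inv_radiiMat_mul_hessMat_norm huh hz₀ hA, smul_eq_mul] at htr
  have hWt := hu.hasDerivAt_derivWithin hT hz₀ ht₀T
  have hexp : HasDerivAt (fun s => Real.exp (-(M + 1) * s))
      (Real.exp (-(M + 1) * t₀) * (-(M + 1))) t₀ := by
    have := ((hasDerivAt_id t₀).const_mul (-(M + 1))).exp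
    simpa using this
  have hder := deriv_nonneg_of_forall_le_left ht₀pos (hWt.mul hexp) (by
      intro s hs1 hs2
      exact hmax' z₀ hz₀ s ⟨hs1, hs2.trans ht₀.2⟩)
  rw [← hc] at hder
  set D := (radiiMat n (fun x => u x t₀) z₀).det ^ (-α) with hD
  have hDpos : 0 < D := Real.rpow_pos_of_pos hA.det_pos _
  have hMbd : α * D * ((radiiMat n (fun x => u x t₀) z₀)⁻¹.trace - 1) ≤ M :=
    hM (a := (z₀, t₀)) ⟨hz₀, ht₀⟩
  have hβ : 0 ≤ deriv P.β (u z₀ t₀ - Φ.φ z₀ t₀) * (c - Φ.φt z₀ t₀) :=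
    mul_nonneg P.mono.deriv_nonneg (by linarith [Φ.φt_neg z₀ hz₀ t₀ ht₀T.1.le])
  set τ := (radiiMat n (fun x => u x t₀) z₀)⁻¹.trace - 1 with hτ
  set S := ((radiiMat n (fun x => u x t₀) z₀)⁻¹ *
    hessMat n (fun x => derivWithin (u x) (Ico 0 T) t₀) z₀).trace with hS
  have h1 : α * D * S ≤ c * M :=
    calc α * D * S ≤ α * D * (c * τ) :=
          mul_le_mul_of_nonneg_left (by linarith) (by positivity)
      _ = c * (α * D * τ) := by ring
      _ ≤ c * M := mul_le_mul_of_nonneg_left hMbd hcpos.le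
  have h2 : 0 ≤ (α * D * S - deriv P.β (u z₀ t₀ - Φ.φ z₀ t₀) * (c - Φ.φt z₀ t₀)
      - c * (M + 1)) * Real.exp (-(M + 1) * t₀) := by
    linarith
  have h3 := nonneg_of_mul_nonneg_left h2 (Real.exp_pos _)
  linarith

/-- Tso's estimate for the speed divided by `u - ρ`. -/
lemma neg_derivWithin_le_mul_sub (hn : 0 < n) (hT : 0 < T) (hα : 0 < α)
    (hu : IsPenalizedSol n α T δ C₀ Φ P u) {ρ m : ℝ} (hρ : 0 < ρ)
    (hlow : ∀ z ∈ Sph n, ∀ t ∈ Ico 0 T, 2 * ρ ≤ u z t)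
    (hm : ((n * α + 1) / (n * α * ρ)) ^ ((n : ℝ) * α) ≤ m)
    (h0 : ∀ z ∈ Sph n, -derivWithin (u z) (Ico 0 T) 0 ≤ m)
    (hφ : ∀ z ∈ Sph n, ∀ t ∈ Ico 0 T, -Φ.φt z t ≤ m)
    {z : ES n} (hz : z ∈ Sph n) {t : ℝ} (ht : t ∈ Ico 0 T) :
    -derivWithin (u z) (Ico 0 T) t ≤ m / ρ * (u z t - ρ) := by
  have hn' : (0 : ℝ) < n := by exact_mod_cast hn
  have hm0 : 0 ≤ m := le_trans (by positivity) hm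
  have hsub : Sph n ×ˢ Icc 0 t ⊆ Sph n ×ˢ Ico 0 T :=
    prod_mono Subset.rfl fun s hs => ⟨hs.1, hs.2.trans_lt ht.2⟩
  have hbase : IsCompact (Sph n ×ˢ Icc 0 t) := (sph_isCompact n).prod isCompact_Icc
  have hne : (Sph n ×ˢ Icc 0 t).Nonempty := ⟨(z, t), hz, ht.1, le_rfl⟩
  have hupos : ∀ y ∈ Sph n, ∀ s ∈ Ico 0 T, ρ ≤ u y s - ρ := fun y hy s hs => by
    linarith [hlow y hy s hs]
  have hg : ContinuousOn (fun p : ES n × ℝ =>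
      -derivWithin (u p.1) (Ico 0 T) p.2 / (u p.1 p.2 - ρ)) (Sph n ×ˢ Icc 0 t) := by
    refine (hu.continuousOn_derivWithin.mono hsub).neg.div
      ((hu.continuousOn.mono hsub).sub continuousOn_const) fun p hp => ?_
    linarith [hupos p.1 (hsub hp).1 p.2 (hsub hp).2]
  obtain ⟨⟨z₀, t₀⟩, ⟨hz₀, ht₀⟩, hmax⟩ := hbase.exists_isMaxOn hne hg
  simp only at hz₀ ht₀
  have ht₀I : t₀ ∈ Ico 0 T := ⟨ht₀.1, ht₀.2.trans_lt ht.2⟩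
  have hup₀ := hupos z₀ hz₀ t₀ ht₀I
  have hup₀' : 0 < u z₀ t₀ - ρ := hρ.trans_le hup₀
  set v₀ : ℝ := -derivWithin (u z₀) (Ico 0 T) t₀ with hv₀
  set q : ℝ := v₀ / (u z₀ t₀ - ρ) with hq
  have hmax' : ∀ y ∈ Sph n, ∀ s ∈ Icc 0 t,
      -derivWithin (u y) (Ico 0 T) s ≤ q * (u y s - ρ) := by
    intro y hy s hs
    have h1 : -derivWithin (u y) (Ico 0 T) s / (u y s - ρ) ≤ q := hmax (a := (y, s)) ⟨hy, hs⟩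
    have h2 := hupos y hy s ⟨hs.1, hs.2.trans_lt ht.2⟩
    rwa [div_le_iff₀ (by linarith)] at h1
  have hqv : q * (u z₀ t₀ - ρ) = v₀ := div_mul_cancel₀ _ hup₀'.ne'
  suffices hv : v₀ ≤ m by
    refine (hmax' z hz t ⟨ht.1, le_rfl⟩).trans ?_
    refine mul_le_mul_of_nonneg_right ?_ (hρ.le.trans (hupos z hz t ht))
    exact div_le_div₀ hm0 hv hρ hup₀
  rcases ht₀.1.eq_or_lt with h | ht₀pos
  · rw [hv₀, ← h]; exact h0 z₀ hz₀
  by_cases hφv : v₀ ≤ -Φ.φt z₀ t₀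
  · exact hφv.trans (hφ z₀ hz₀ t₀ ht₀I)
  push Not at hφv
  have hv₀pos : 0 < v₀ := by linarith [Φ.φt_neg z₀ hz₀ t₀ ht₀.1]
  have hqpos : 0 < q := div_pos hv₀pos hup₀'
  have ht₀T : t₀ ∈ Ioo 0 T := ⟨ht₀pos, ht₀I.2⟩
  have huh := hu.isHomogC2 ht₀I
  have hWh := hu.isHomogC2_derivWithin ht₀I
  have hA := hu.radiiMat_posDef hz₀ ht₀I
  have hquh := huh.const_mul q
  have hnWh := hWh.const_mul (-1)
  have hpsd := ((hquh.sub hnWh).sub (isHomogC2_norm.const_mul (q * ρ))).hessMat_posSemidef hz₀ (by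
      intro y hy
      have h1 := hmax' y hy t₀ ht₀
      rw [norm_of_mem_sph hy]
      linarith) (by rw [norm_of_mem_sph hz₀]; linarith)
  rw [hessMat_sub (hquh.sub hnWh) (isHomogC2_norm.const_mul (q * ρ)) hz₀,
    hessMat_sub hquh hnWh hz₀, hessMat_const_mul huh q hz₀, hessMat_const_mul hWh (-1) hz₀,
    hessMat_const_mul isHomogC2_norm (q * ρ) hz₀] at hpsd
  have htr := trace_inv_mul_nonneg hA hpsd
  simp only [Matrix.mul_sub, Matrix.mul_smul, Matrix.trace_sub, Matrix.trace_smul,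
    trace_inv_radiiMat_mul_hessMat_norm huh hz₀ hA, trace_inv_radiiMat_mul_hessMat huh hz₀ hA,
    smul_eq_mul] at htr
  have hτ := card_sub_one_mul_rpow_le_trace_inv hn hA (huh.radiiMat_mulVec_self hz₀)
    (dotProduct_self_of_mem_sph hz₀)
  have hWt := hu.hasDerivAt_derivWithin hT hz₀ ht₀T
  have hud := (hu.hasDerivWithinAt hz₀ ht₀I).hasDerivAt (Ico_mem_nhds ht₀T.1 ht₀T.2)
  have hder := deriv_nonneg_of_forall_le_left ht₀pos (hWt.neg.sub ((hud.sub_const ρ).const_mul q))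
    (by
      intro s hs1 hs2
      have h1 := hmax' z₀ hz₀ s ⟨hs1, hs2.trans ht₀.2⟩
      simp only [Pi.sub_apply, Pi.neg_apply]
      linarith)
  have hv₀D : v₀ ≤ (radiiMat n (fun x => u x t₀) z₀).det ^ (-α) := by
    rw [hv₀, hu.derivWithin_eq hT hz₀ ht₀I]
    linarith [P.nonpos (u z₀ t₀ - Φ.φ z₀ t₀)]
  have hdet := hA.det_pos
  have hβ : 0 ≤ deriv P.β (u z₀ t₀ - Φ.φ z₀ t₀) * (v₀ + Φ.φt z₀ t₀) :=
    mul_nonneg P.mono.deriv_nonneg (by linarith)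
  set d := (radiiMat n (fun x => u x t₀) z₀).det with hd
  set k := d ^ (-(1 / (n : ℝ))) with hk
  have hkpos : 0 < k := Real.rpow_pos_of_pos hdet _
  have hkD : d ^ (-α) = k ^ ((n : ℝ) * α) := by
    rw [hk, ← Real.rpow_mul hdet.le]
    congr 1
    field_simp
  set D := d ^ (-α) with hD
  have hDpos : 0 < D := Real.rpow_pos_of_pos hdet _
  set τ := (radiiMat n (fun x => u x t₀) z₀)⁻¹.trace - 1 with hτdef
  set S := ((radiiMat n (fun x => u x t₀) z₀)⁻¹ *
    hessMat n (fun x => derivWithin (u x) (Ico 0 T) t₀) z₀).trace with hS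
  have hW : derivWithin (u z₀) (Ico 0 T) t₀ = -v₀ := by rw [hv₀, neg_neg]
  rw [hW] at hder
  have h1 : α * D * (q * (ρ * (n * k) - n)) ≤ q * v₀ := by
    have h2 : q * (ρ * (n * k) - n) ≤ S := by
      have h3 : q * ρ * (n * k) ≤ q * ρ * τ := mul_le_mul_of_nonneg_left hτ (by positivity)
      linarith
    have h4 := mul_le_mul_of_nonneg_left h2 (show 0 ≤ α * D by positivity)
    linarith
  have h5 : α * D * (ρ * (n * k) - n) ≤ D := by
    refine le_trans ?_ hv₀D
    refine le_of_mul_le_mul_left ?_ hqpos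
    linarith
  have h6 : α * (ρ * (n * k) - n) ≤ 1 := by
    refine le_of_mul_le_mul_left ?_ hDpos
    linarith
  have h7 : k ≤ (n * α + 1) / (n * α * ρ) := by
    rw [le_div_iff₀ (by positivity)]
    linarith
  calc v₀ ≤ D := hv₀D
    _ = k ^ ((n : ℝ) * α) := hkD
    _ ≤ ((n * α + 1) / (n * α * ρ)) ^ ((n : ℝ) * α) :=
      Real.rpow_le_rpow hkpos.le h7 (by positivity)
    _ ≤ m := hm

lemma suppHessDet_initial (hT : 0 < T) (hu : IsPenalizedSol n α T δ C₀ Φ P u) {u₀ : ES n → ℝ}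
    (hbody : IsSupportOfSmoothBody n u₀) (hinit : ∀ z ∈ Sph n, u z 0 = u₀ z)
    {z : ES n} (hz : z ∈ Sph n) :
    suppHessDet n u₀ z = (radiiMat n (fun x => u x 0) z).det := by
  have heq : ∀ x : ES n, x ≠ 0 → u x 0 = u₀ x := by
    intro x hx
    have hx' := norm_pos_iff.2 hx
    have hy : ‖x‖⁻¹ • x ∈ Sph n := by
      simp [Sph, norm_smul, hx'.ne']
    have h1 := hu.homog 0 ⟨le_rfl, hT⟩ ‖x‖ hx' (‖x‖⁻¹ • x)
    have h2 := hbody.1 ‖x‖ hx' (‖x‖⁻¹ • x)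
    rw [smul_inv_smul₀ hx'.ne'] at h1 h2
    rw [h1, h2, hinit _ hy]
  have hev : u₀ =ᶠ[𝓝 z] fun x => u x 0 := by
    filter_upwards [isOpen_compl_singleton.mem_nhds (ne_zero_of_mem_sph hz)] with x hx
    exact (heq x hx).symm
  rw [← suppHessDet_eq_det_radiiMat]
  simp only [suppHessDet, hbil_congr hev]

lemma neg_derivWithin_zero (hT : 0 < T) (hu : IsPenalizedSol n α T δ C₀ Φ P u) {u₀ : ES n → ℝ}
    (hbody : IsSupportOfSmoothBody n u₀) (hinit : ∀ z ∈ Sph n, u z 0 = u₀ z)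
    (hδ : ∀ z ∈ Sph n, δ < u₀ z - Φ.φ z 0) {z : ES n} (hz : z ∈ Sph n) :
    -derivWithin (u z) (Ico 0 T) 0 = ((suppHessDet n u₀ z)⁻¹) ^ α := by
  have h0 : (0 : ℝ) ∈ Ico 0 T := ⟨le_rfl, hT⟩
  have hpos := (hu.radiiMat_posDef hz h0).det_pos
  rw [hu.derivWithin_eq hT hz h0, P.zero_of_ge _ (by rw [hinit z hz]; exact (hδ z hz).le),
    hu.suppHessDet_initial hT hbody hinit hz, Real.inv_rpow hpos.le, Real.rpow_neg hpos.le]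
  ring

lemma le_initial (hu : IsPenalizedSol n α T δ C₀ Φ P u) {z : ES n} (hz : z ∈ Sph n)
    (h : ∀ t ∈ Ico 0 T, derivWithin (u z) (Ico 0 T) t ≤ 0) {t : ℝ} (ht : t ∈ Ico 0 T) :
    u z t ≤ u z 0 := by
  have hanti : AntitoneOn (u z) (Ico 0 T) := by
    refine antitoneOn_of_deriv_nonpos (convex_Ico 0 T)
      (fun s hs => (hu.hasDerivWithinAt hz hs).continuousWithinAt) ?_ ?_
    · intro s hs
      exact ((hu.hasDerivWithinAt hz (interior_subset hs)).mono interior_subset).differentiableWithinAt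
    · intro s hs
      rw [← derivWithin_of_mem_nhds (mem_interior_iff_mem_nhds.1 hs)]
      exact h s (interior_subset hs)
  exact hanti ⟨le_rfl, ht.1.trans_lt ht.2⟩ ht ht.1

end IsPenalizedSol

end PenalizedFlow

theorem statement_8 (n : ℕ) (hn : 0 < n) (α : ℝ) (hα : 0 < α)
    (T : ℝ) (hT : 0 < T) (Φ : ShrinkingObstacle n)
    (u₀ : ES n → ℝ) (hbody : IsSupportOfSmoothBody n u₀)
    (hencl : Encloses n α u₀ Φ)
    (δ C₀ : ℝ) (hδ : 0 < δ) (hδ' : ∀ z ∈ Sph n, δ < u₀ z - Φ.φ z 0)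
    (hC₀ : PenaltyConst n α Φ C₀) (P : Penalty δ C₀)
    (u : ES n → ℝ → ℝ) (hu : IsPenalizedSol n α T δ C₀ Φ P u)
    (hinit : ∀ z ∈ Sph n, u z 0 = u₀ z) :
    -- `ρ₀ = ½ min_{𝕊ⁿ} φ_∞` (the support function of the limit body is the infimum of the
    -- decreasing family `φ(·,t)`), `max_{𝕊ⁿ} K₀^α` is the maximal power of the Gauss
    -- curvature of `Σ₀`, and the explicit constant is
    -- `C = (max_{𝕊ⁿ} u₀)·ρ₀⁻¹·max{max_{𝕊ⁿ} K₀^α, ((nα+1)/(nαρ₀))^{nα}}`.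
    (fun ρ₀ : ℝ =>
        ∀ z ∈ Sph n, ∀ t ∈ Set.Ico (0 : ℝ) T,
          -deriv (u z) t ≤
            sSup {y : ℝ | ∃ z' ∈ Sph n, y = u₀ z'} * ρ₀⁻¹ *
              max (sSup {y : ℝ | ∃ z' ∈ Sph n, y = ((suppHessDet n u₀ z')⁻¹) ^ α})
                ((((n : ℝ) * α + 1) / ((n : ℝ) * α * ρ₀)) ^ ((n : ℝ) * α)))
      ((1 / 2) * sInf {y : ℝ | ∃ z' ∈ Sph n, ∃ t' : ℝ, 0 ≤ t' ∧ y = Φ.φ z' t'}) := by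
  intro z hz t ht
  set s := sInf {y : ℝ | ∃ z' ∈ Sph n, ∃ t' : ℝ, 0 ≤ t' ∧ y = Φ.φ z' t'} with hs
  set ρ₀ : ℝ := 1 / 2 * s with hρ₀
  set k₀ := sSup {y : ℝ | ∃ z' ∈ Sph n, y = ((suppHessDet n u₀ z')⁻¹) ^ α} with hk₀
  set m := max k₀ ((((n : ℝ) * α + 1) / ((n : ℝ) * α * ρ₀)) ^ ((n : ℝ) * α)) with hm
  set U := sSup {y : ℝ | ∃ z' ∈ Sph n, y = u₀ z'} with hU
  have h0T : (0 : ℝ) ∈ Set.Ico 0 T := ⟨le_rfl, hT⟩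
  obtain ⟨ρ, hρ, hφρ⟩ := Φ.interior_point
  have hspos : 0 < s := by
    refine hρ.trans_le (le_csInf ?_ ?_)
    · exact ⟨_, z, hz, 0, le_rfl, rfl⟩
    · rintro y ⟨z', hz', t', ht', rfl⟩
      exact hφρ z' hz' t' ht'
  have hsφ : ∀ z ∈ Sph n, ∀ t : ℝ, 0 ≤ t → s ≤ Φ.φ z t := by
    intro z hz t ht
    refine csInf_le ⟨ρ, ?_⟩ ⟨z, hz, t, ht, rfl⟩
    rintro y ⟨z', hz', t', ht', rfl⟩
    exact hφρ z' hz' t' ht'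
  have hρ₀pos : 0 < ρ₀ := by positivity
  have hlow : ∀ z ∈ Sph n, ∀ t ∈ Set.Ico 0 T, 2 * ρ₀ ≤ u z t := by
    intro z hz t ht
    have h1 := hu.obstacle_lt hα hC₀
      (fun z hz => by rw [hinit z hz]; exact hencl.1 z hz) hz ht
    linarith [hsφ z hz t ht.1]
  have hv₀ := fun {z : ES n} (hz : z ∈ Sph n) =>
    hu.neg_derivWithin_zero hT hbody hinit hδ' hz
  have hmk : ContinuousOn (fun z : ES n => (z, (0 : ℝ))) (Sph n) := by fun_prop
  have hmaps : Set.MapsTo (fun z : ES n => (z, (0 : ℝ))) (Sph n) (Sph n ×ˢ Set.Ico 0 T) :=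
    fun z hz => ⟨hz, h0T⟩
  have hk₀le : ∀ z ∈ Sph n, ((suppHessDet n u₀ z)⁻¹) ^ α ≤ k₀ := by
    intro z hz
    refine le_csSup (bddAbove_image_sph ?_) ⟨z, hz, rfl⟩
    refine ContinuousOn.congr ?_ fun z hz => (hv₀ hz).symm
    exact (hu.continuousOn_derivWithin.comp hmk hmaps).neg
  have hUle : ∀ z ∈ Sph n, u₀ z ≤ U := by
    intro z hz
    refine le_csSup (bddAbove_image_sph ?_) ⟨z, hz, rfl⟩
    exact (hu.continuousOn.comp hmk hmaps).congr fun z hz => (hinit z hz).symm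
  have hspeed : ∀ z ∈ Sph n, ∀ t ∈ Set.Ico 0 T, -Φ.φt z t ≤ m := by
    intro z hz t ht
    have h1 := Φ.speed_nonincreasing z hz 0 t le_rfl ht.1
    have h2 := hencl.2.1 z hz z hz
    linarith [hk₀le z hz, le_max_left k₀ ((((n : ℝ) * α + 1) / ((n : ℝ) * α * ρ₀)) ^ ((n : ℝ) * α))]
  have hneg : ∀ z ∈ Sph n, derivWithin (u z) (Set.Ico 0 T) 0 < 0 := by
    intro z hz
    linarith [hv₀ hz, hencl.2.1 z hz z hz, Φ.φt_neg z hz 0 le_rfl]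
  have hmain := hu.neg_derivWithin_le_mul_sub hn hT hα hρ₀pos hlow (le_max_right k₀ _)
    (fun z hz => (hv₀ hz).trans_le ((hk₀le z hz).trans (le_max_left _ _))) hspeed hz ht
  have hm0 : 0 ≤ m := le_max_of_le_right (by positivity)
  have hut : u z t ≤ U := by
    refine (hu.le_initial hz (fun t ht => hu.derivWithin_nonpos hT hα hneg hz ht) ht).trans ?_
    rw [hinit z hz]
    exact hUle z hz
  have hU0 : 0 ≤ U := by linarith [hlow z hz t ht]
  have hbound : -derivWithin (u z) (Set.Ico 0 T) t ≤ U * ρ₀⁻¹ * m :=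
    calc -derivWithin (u z) (Set.Ico 0 T) t ≤ m / ρ₀ * (u z t - ρ₀) := hmain
      _ ≤ m / ρ₀ * U := mul_le_mul_of_nonneg_left (by linarith) (by positivity)
      _ = U * ρ₀⁻¹ * m := by ring
  by_cases hd : DifferentiableAt ℝ (u z) t
  · rwa [← hd.derivWithin (uniqueDiffOn_Ico 0 T t ht)]
  · rw [deriv_zero_of_not_differentiableAt hd, neg_zero]
    positivity
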